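/- arXiv:2505.22743 — 2 statements merged into one kernel-verified Lean document; each statement's English description precedes it below -/
import Mathlib

section
/- Low-degree hardness for round-based protocols with adaptivity within blocks: let n, k, m_0, m_1, D ≥ 1, m = m_0·m_1, and let μ be a finitely supported probability distribution over n-qubit density matrices. For a single-copy measurement in an orthonormal basis (φ_s) of ℂ^{2^n}, write D̄_ρ(s) = 2^n⟨φ_s, ρ φ_s⟩ and D̄_ρ^{≤D} for its degree-≤D truncation in L²(uniform on {0,1}^n). Assume: (i) for every adaptive sequence of k·m_0 − 1 single-copy measurements (the orthonormal basis used for copy i being an arbitrary function of the previous outcomes s_1,…,s_{i−1} ∈ {0,1}^n), E_{s_1,…,s_{k m_0 −1} ∼ uniform i.i.d.} E_{ρ∼μ}[ ( ∏_{i=1}^{k m_0 −1} D̄_ρ^{≤D}(s_i | s_{<i}) )^{2(k m_0 −1)} ] ≤ M, where D̄_ρ^{≤D}(·|s_{<i}) is the degree-≤D truncation, in the bits of s_i, of the conditional single-copy likelihood ratio for the basis chosen after history s_{<i}; and (ii) for every orthonormal basis of ℂ^{2^n}, E_{ρ,ρ'∼μ}[ ( ⟨D̄_ρ^{≤D}, D̄_{ρ'}^{≤D}⟩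 − 1 )^{2 k m_0} ] ≤ ε. Then for every protocol consisting of m_1 blocks of m_0 copies, where the measurement bases within each block are adaptively chosen from the outcomes of earlier copies in the same block and no adaptivity is allowed across blocks, the truncated likelihood ratio G_ρ(S) = ∏ over all m copies of the per-copy degree-≤D truncated conditional likelihood ratios satisfies ‖ (E_{ρ∼μ}[G_ρ])^{≤ k copies} − 1 ‖² ≤ k³ · 2^k · m_1^k · (k m_0)^{k²} · ε^{1/(2 k m_0)} · M, where ^{≤ k copies} denotes the orthogonal projection in L²(uniform on ({0,1}^n)^m) onto the span of functions depending on at most k of the m copies, and ‖·‖ is the corresponding L² norm. -/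
open Matrix BigOperators Finset
open scoped ComplexOrder

/-- `φ` is an orthonormal basis of `ℂ^ι`. -/
def IsONB {ι : Type*} [Fintype ι] [DecidableEq ι] (φ : ι → ι → ℂ) : Prop :=
  ∀ s t, star (φ s) ⬝ᵥ φ t = if s = t then 1 else 0

/-- The Fourier character `χ_S(s) = (−1)^{Σ_{j∈S} s_j}` on `{0,1}^n`. -/
def chiB {n : ℕ} (S : Finset (Fin n)) (s : Fin n → Fin 2) : ℝ :=
  (-1 : ℝ) ^ (∑ j ∈ S, (s j).val)

/-- The `L²` inner product with respect to the uniform distribution on `{0,1}^n`. -/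
noncomputable def innerB (n : ℕ) (f g : (Fin n → Fin 2) → ℝ) : ℝ :=
  ((2 : ℝ) ^ n)⁻¹ * ∑ s, f s * g s

/-- The orthogonal projection of `g : {0,1}^n → ℝ` onto `span{χ_S : |S| ≤ D}`. -/
noncomputable def truncD (n D : ℕ) (g : (Fin n → Fin 2) → ℝ) :
    (Fin n → Fin 2) → ℝ :=
  fun s => ∑ S : Finset (Fin n),
    if S.card ≤ D then innerB n g (chiB S) * chiB S s else 0

/-- The single-copy likelihood ratio `D̄_ρ(s) = 2^n·⟨φ_s, ρ φ_s⟩`. -/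
noncomputable def Dbar (n : ℕ) (φ : (Fin n → Fin 2) → (Fin n → Fin 2) → ℂ)
    (ρ : Matrix (Fin n → Fin 2) (Fin n → Fin 2) ℂ) : (Fin n → Fin 2) → ℝ :=
  fun s => (2 : ℝ) ^ n * (star (φ s) ⬝ᵥ (ρ *ᵥ φ s)).re

/-- The product character over the `m₁·m₀` copies. -/
def chiBig {n m₀ m₁ : ℕ} (S : Fin m₁ → Fin m₀ → Finset (Fin n))
    (s : Fin m₁ → Fin m₀ → Fin n → Fin 2) : ℝ :=
  ∏ b, ∏ j, chiB (S b j) (s b j)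

/-- The `L²` inner product with respect to the uniform distribution on the readouts of
all `m₁·m₀` copies. -/
noncomputable def innerBig (n m₀ m₁ : ℕ)
    (F G : (Fin m₁ → Fin m₀ → Fin n → Fin 2) → ℝ) : ℝ :=
  ((2 : ℝ) ^ (m₁ * m₀ * n))⁻¹ * ∑ s, F s * G s

/-- Orthogonal projection onto the span of functions depending on at most `k` of the
`m₁·m₀` copies. -/
noncomputable def truncCopies (n m₀ m₁ k : ℕ)
    (F : (Fin m₁ → Fin m₀ → Fin n → Fin 2) → ℝ) :
    (Fin m₁ → Fin m₀ → Fin n → Fin 2) → ℝ :=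
  fun s => ∑ S : Fin m₁ → Fin m₀ → Finset (Fin n),
    if (Finset.univ.filter fun p : Fin m₁ × Fin m₀ => S p.1 p.2 ≠ ∅).card ≤ k then
      innerBig n m₀ m₁ F (chiBig S) * chiBig S s
    else 0

lemma exists_strictMonoOn_rank {ι : Type*} {r : ι → ℕ} (hr : Function.Injective r) (Q : Finset ι) {L : ℕ} (hL : 0 < L)
    (hQL : #Q ≤ L) :
    ∃ e : ι → Fin L, Set.InjOn e Q ∧ ∀ p ∈ Q, ∀ q ∈ Q, r p < r q → e p < e q := by
  have hlt : ∀ p ∈ Q, #{q ∈ Q | r q < r p} < L := fun p hp =>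
    (card_lt_card (filter_ssubset.2 ⟨p, hp, lt_irrefl (r p)⟩)).trans_le hQL
  let e : ι → Fin L := fun p => ⟨#{q ∈ Q | r q < r p} % L, Nat.mod_lt _ hL⟩
  have he : ∀ p ∈ Q, ∀ q ∈ Q, r p < r q → e p < e q := fun p hp q hq hpq => by
    rw [Fin.lt_def]
    simp only [e, Nat.mod_eq_of_lt (hlt p hp), Nat.mod_eq_of_lt (hlt q hq)]
    refine card_lt_card ⟨fun a ha => ?_, fun h => ?_⟩
    · rw [mem_filter] at ha ⊢
      exact ⟨ha.1, ha.2.trans hpq⟩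
    · exact lt_irrefl (r p) (mem_filter.1 (h (mem_filter.2 ⟨hp, hpq⟩))).2
  refine ⟨e, fun p hp q hq h => ?_, he⟩
  rcases lt_trichotomy (r p) (r q) with hlt | heq | hlt
  · exact absurd h (he p hp q hq hlt).ne
  · exact hr heq
  · exact absurd h (he q hq p hp hlt).ne'

section Expectation

variable {ι κ V J : Type*} [Fintype ι] [DecidableEq ι] [Fintype κ] [DecidableEq κ]
  [Fintype V] [Nonempty V] [Fintype J]

/-- Resampling one coordinate does not change an expectation over independent uniform
coordinates. -/
lemma expect_eq_expect_update (p : ι) (f : (ι → V) → ℝ) :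
    𝔼 s, f s = 𝔼 s, 𝔼 v, f (Function.update s p v) := by
  have h : 𝔼 x : (ι → V) × V, f x.1 = 𝔼 x : (ι → V) × V, f (Function.update x.1 p x.2) := by
    have hinv : Function.Involutive
        (fun x : (ι → V) × V => ((Function.update x.1 p x.2, x.1 p) : (ι → V) × V)) := by
      rintro ⟨s, v⟩
      simp
    exact (Fintype.expect_equiv hinv.toPerm (fun x => f (Function.update x.1 p x.2))
      (fun x => f x.1) (fun x => rfl)).symm
  rw [← univ_product_univ, expect_product, expect_product] at h
  simpa using h

/-- The restriction of independent uniform coordinates along an injection is again uniform. -/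
lemma expect_comp_injective {e : κ → ι} (he : Function.Injective e) (f : (κ → V) → ℝ) :
    𝔼 s : ι → V, f (s ∘ e) = 𝔼 t, f t := by
  have h : 𝔼 x : (ι → V) × (κ → V), f (x.1 ∘ e) = 𝔼 x : (ι → V) × (κ → V), f x.2 := by
    have hinv : Function.Involutive (fun x : (ι → V) × (κ → V) =>
        ((Function.extend e x.2 x.1, x.1 ∘ e) : (ι → V) × (κ → V))) := by
      rintro ⟨s, t⟩
      refine Prod.ext ?_ (Function.extend_comp he _ _)
      funext i
      by_cases hi : ∃ a, e a = i
      · obtain ⟨a, rfl⟩ := hi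
        simp [he.extend_apply]
      · simp [Function.extend_apply' _ _ _ hi]
    exact Fintype.expect_equiv hinv.toPerm _ _ (fun x => rfl)
  rw [← univ_product_univ, expect_product, expect_product] at h
  simpa using h

/-- A function of the coordinates in `Q` has the same expectation after these coordinates are
read off from another product space through a map that is injective on `Q`. -/
lemma expect_eq_expect_comp_of_injOn {Q : Finset ι} {e : ι → κ} (he : Set.InjOn e Q)
    (f : (ι → V) → ℝ) (hf : ∀ s s', (∀ p ∈ Q, s p = s' p) → f s = f s') :
    𝔼 s, f s = 𝔼 t : κ → V, f (t ∘ e) := by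
  obtain ⟨v₀⟩ := ‹Nonempty V›
  let g : ({p // p ∈ Q} → V) → ℝ := fun u => f (Function.extend Subtype.val u fun _ => v₀)
  have hg : ∀ s : ι → V, g (fun p => s p) = f s := fun s => hf _ _ fun p hp => by
    exact Subtype.val_injective.extend_apply (fun p : {p // p ∈ Q} => s p) _ ⟨p, hp⟩
  have h1 := expect_comp_injective (Subtype.val_injective (p := (· ∈ Q))) g
  have h2 := expect_comp_injective (e := fun p : {p // p ∈ Q} => e p)
    (fun p q h => Subtype.ext (he p.2 q.2 h)) g
  rw [← h2] at h1
  calc 𝔼 s, f s = 𝔼 s : ι → V, g (s ∘ Subtype.val) := by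
        exact expect_congr rfl fun s _ => (hg s).symm
    _ = _ := h1
    _ = _ := expect_congr rfl fun t _ => hg (t ∘ e)

lemma expect_mul_apply (p : ι) (Φ : (ι → V) → ℝ) (h : (ι → V) → V → ℝ)
    (hΦ : ∀ s v, Φ (Function.update s p v) = Φ s)
    (hh : ∀ s v, h (Function.update s p v) = h s) :
    𝔼 s, Φ s * h s (s p) = 𝔼 s, Φ s * 𝔼 v, h s v := by
  rw [expect_eq_expect_update p]
  simp [hΦ, hh, mul_expect]

lemma one_le_expect_sq {h : V → ℝ} (h1 : 𝔼 v, h v = 1) : 1 ≤ 𝔼 v, h v ^ 2 := by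
  have : 0 ≤ 𝔼 v, (h v - 1) ^ 2 := expect_nonneg fun v _ => sq_nonneg _
  have h2 : 𝔼 v, (h v - 1) ^ 2 = 𝔼 v, h v ^ 2 - 2 * 𝔼 v, h v + 1 := by
    rw [mul_expect, ← expect_sub_distrib, ← Fintype.expect_const (ι := V) (1 : ℝ),
      ← expect_add_distrib]
    exact expect_congr rfl fun v _ => by simp; ring
  rw [h2, h1] at this
  linarith

variable {r : ι → ℕ} {d : ι → (ι → V) → V → ℝ}

/-- Conditional likelihood ratios of copies on which nothing else depends integrate to one. -/
lemma expect_mul_prod_eq (hd : ∀ p s s', (∀ q, r q < r p → s q = s' q) → d p s = d p s')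
    (hmean : ∀ p s, 𝔼 v, d p s v = 1) (W : Finset ι) (Φ : (ι → V) → ℝ)
    (hΦ : ∀ p ∈ W, ∀ s v, Φ (Function.update s p v) = Φ s) :
    𝔼 s, Φ s * ∏ p ∈ W, d p s (s p) = 𝔼 s, Φ s := by
  have hupd : ∀ p q, r q ≤ r p → ∀ s v, d q (Function.update s p v) = d q s := by
    intro p q hqp s v
    refine hd q _ _ fun a ha => Function.update_of_ne ?_ _ _
    rintro rfl
    omega
  induction W using Finset.induction_on_max_value r with
  | empty => simp
  | insert p W hp hmax ih =>
    rw [← ih fun q hq => hΦ q (mem_insert_of_mem hq)]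
    have := expect_mul_apply p (fun s => Φ s * ∏ q ∈ W, d q s (s q)) (d p) (fun s v => by
      rw [hΦ p (mem_insert_self p W)]
      congr 1
      refine prod_congr rfl fun q hq => ?_
      rw [hupd p q (hmax q hq), Function.update_of_ne (ne_of_mem_of_not_mem hq hp)])
      (hupd p p le_rfl)
    simp only [hmean, mul_one] at this
    rw [← this]
    exact expect_congr rfl fun s _ => by rw [prod_insert hp]; ring

lemma expect_le_expect_mul_prod_sq
    (hd : ∀ p s s', (∀ q, r q < r p → s q = s' q) → d p s = d p s')
    (hmean : ∀ p s, 𝔼 v, d p s v = 1) (W : Finset ι) (Φ : (ι → V) → ℝ) (hΦ0 : ∀ s, 0 ≤ Φ s)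
    (hΦ : ∀ p ∈ W, ∀ s v, Φ (Function.update s p v) = Φ s) :
    𝔼 s, Φ s ≤ 𝔼 s, Φ s * ∏ p ∈ W, d p s (s p) ^ 2 := by
  have hupd : ∀ p q, r q ≤ r p → ∀ s v, d q (Function.update s p v) = d q s := by
    intro p q hqp s v
    refine hd q _ _ fun a ha => Function.update_of_ne ?_ _ _
    rintro rfl
    omega
  induction W using Finset.induction_on_max_value r with
  | empty => simp
  | insert p W hp hmax ih =>
    refine (ih fun q hq => hΦ q (mem_insert_of_mem hq)).trans ?_
    have := expect_mul_apply p (fun s => Φ s * ∏ q ∈ W, d q s (s q) ^ 2)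
      (fun s v => d p s v ^ 2) (fun s v => by
      rw [hΦ p (mem_insert_self p W)]
      congr 1
      refine prod_congr rfl fun q hq => ?_
      rw [hupd p q (hmax q hq), Function.update_of_ne (ne_of_mem_of_not_mem hq hp)])
      (fun s v => by rw [hupd p p le_rfl])
    calc 𝔼 s, Φ s * ∏ q ∈ W, d q s (s q) ^ 2
        ≤ 𝔼 s, (Φ s * ∏ q ∈ W, d q s (s q) ^ 2) * 𝔼 v, d p s v ^ 2 :=
          expect_le_expect fun s _ => le_mul_of_one_le_right
            (mul_nonneg (hΦ0 s) (prod_nonneg fun q _ => sq_nonneg _))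
            (one_le_expect_sq (hmean p s))
      _ = _ := by
          rw [← this]
          exact expect_congr rfl fun s _ => by rw [prod_insert hp]; ring

/-- The second moment of a random variable of mean one is at most any higher even moment. -/
lemma expect_sum_sq_le_expect_sum_pow {Ω : Type*} [Fintype Ω] [Nonempty Ω] {w : J → ℝ}
    (hw0 : ∀ j, 0 ≤ w j) (G : J → Ω → ℝ)
    (hG : ∀ j, 𝔼 x, G j x = 1) {a : ℕ} (ha : a ≠ 0) :
    𝔼 x, ∑ j, w j * G j x ^ 2 ≤ 𝔼 x, ∑ j, w j * G j x ^ (2 * a) := by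
  obtain ⟨a, rfl⟩ := Nat.exists_eq_succ_of_ne_zero ha
  have h1 : ∀ j, 1 ≤ 𝔼 x, G j x ^ 2 := fun j => one_le_expect_sq (hG j)
  rw [expect_sum_comm, expect_sum_comm]
  refine sum_le_sum fun j _ => ?_
  rw [← mul_expect, ← mul_expect]
  refine mul_le_mul_of_nonneg_left ?_ (hw0 j)
  have h2 : ∀ x, G j x ^ 2 + a * (G j x ^ 2 - 1) ≤ G j x ^ (2 * (a + 1)) := fun x => by
    have := one_add_mul_le_pow (a := G j x ^ 2 - 1) (by nlinarith [sq_nonneg (G j x)]) (a + 1)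
    rw [pow_mul]
    push_cast at this
    simp only [add_sub_cancel] at this
    linarith
  have h3 : 𝔼 x, (G j x ^ 2 + a * (G j x ^ 2 - 1)) = 𝔼 x, G j x ^ 2 + a * (𝔼 x, G j x ^ 2 - 1) := by
    rw [expect_add_distrib, ← mul_expect, expect_sub_distrib, Fintype.expect_const]
  have h4 := expect_le_expect (s := univ) fun x _ => h2 x
  rw [h3] at h4
  nlinarith [h1 j, mul_nonneg (Nat.cast_nonneg (α := ℝ) a) (sub_nonneg.2 (h1 j))]

/-- A mixture of centred functions is small in `L²` when the centred inner products have a small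
even moment. -/
lemma expect_sum_mul_sub_one_sq_le {w : J → ℝ}
    (hw0 : ∀ j, 0 ≤ w j) (hw1 : ∑ j, w j = 1) (a : J → ℝ) (h : J → V → ℝ)
    (hh : ∀ j, 𝔼 v, h j v = 1) {ε : ℝ} {m : ℕ} (hm : m ≠ 0)
    (hε : ∑ j, ∑ j', w j * w j' * (𝔼 v, h j v * h j' v - 1) ^ (2 * m) ≤ ε) :
    𝔼 v, (∑ j, w j * a j * (h j v - 1)) ^ 2
      ≤ ε ^ ((1 : ℝ) / (2 * m : ℕ)) * ∑ j, w j * a j ^ 2 := by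
  set X : J × J → ℝ := fun x => 𝔼 v, h x.1 v * h x.2 v - 1 with hX
  set W : J × J → ℝ := fun x => w x.1 * w x.2 with hW
  have hW0 : ∀ x, 0 ≤ W x := fun x => mul_nonneg (hw0 _) (hw0 _)
  have hW1 : ∑ x, W x = 1 := by
    rw [Fintype.sum_prod_type, ← hw1, ← sum_mul_sum, hw1, one_mul]
  set Y := 𝔼 v, (∑ j, w j * a j * (h j v - 1)) ^ 2
  set A := ∑ j, w j * a j ^ 2
  have hA : 0 ≤ A := sum_nonneg fun j _ => mul_nonneg (hw0 j) (sq_nonneg _)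
  have hY0 : 0 ≤ Y := expect_nonneg fun v _ => sq_nonneg _
  have hXc : ∀ x, 𝔼 v, (h x.1 v - 1) * (h x.2 v - 1) = X x := fun x => by
    have : ∀ v, (h x.1 v - 1) * (h x.2 v - 1) = (h x.1 v * h x.2 v - h x.1 v) - (h x.2 v - 1) :=
      fun v => by ring
    simp only [this, expect_sub_distrib, hh, Fintype.expect_const, hX]
    ring
  have hY : Y = ∑ x, W x * (X x * (a x.1 * a x.2)) := by
    simp only [Y, sq, sum_mul_sum, ← hXc, expect_sum_comm, Fintype.sum_prod_type, expect_mul,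
      mul_expect, hW]
    refine sum_congr rfl fun i _ => sum_congr rfl fun j _ => expect_congr rfl fun v _ => by ring
  have hAA : A ^ 2 = ∑ x, W x * (a x.1 * a x.2) ^ 2 := by
    simp only [A, sq, sum_mul_sum, Fintype.sum_prod_type, hW]
    exact sum_congr rfl fun i _ => sum_congr rfl fun j _ => by ring
  have hCS : Y ^ 2 ≤ (∑ x, W x * X x ^ 2) * A ^ 2 := by
    rw [hY, hAA]
    refine sum_sq_le_sum_mul_sum_of_sq_le_mul _ (fun x _ => mul_nonneg (hW0 x) (sq_nonneg _))
      (fun x _ => mul_nonneg (hW0 x) (sq_nonneg _)) fun x _ => le_of_eq (by ring)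
  have hJ : (∑ x, W x * X x ^ 2) ^ m ≤ ε := by
    refine (Real.pow_arith_mean_le_arith_mean_pow univ W (fun x => X x ^ 2) (fun x _ => hW0 x) hW1
      (fun x _ => sq_nonneg _) m).trans (le_trans (le_of_eq ?_) hε)
    rw [Fintype.sum_prod_type]
    simp only [hW, hX, pow_mul]
  have hε0 : 0 ≤ ε := le_trans (pow_nonneg (sum_nonneg fun x _ =>
    mul_nonneg (hW0 x) (sq_nonneg _)) m) hJ
  have hm2 : 2 * m ≠ 0 := by omega
  refine le_of_pow_le_pow_left₀ hm2 (mul_nonneg (Real.rpow_nonneg hε0 _) hA) ?_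
  rw [mul_pow, one_div, Real.rpow_inv_natCast_pow hε0 hm2, pow_mul, pow_mul A]
  calc (Y ^ 2) ^ m ≤ ((∑ x, W x * X x ^ 2) * A ^ 2) ^ m := by gcongr
    _ = (∑ x, W x * X x ^ 2) ^ m * (A ^ 2) ^ m := mul_pow _ _ _
    _ ≤ _ := by gcongr


lemma expect_sum_sq_of_orthonormal {Ω σ : Type*} [Fintype Ω] [DecidableEq σ]
    {e : σ → Ω → ℝ} (he : ∀ S T, 𝔼 x, e S x * e T x = if S = T then 1 else 0)
    (K : Finset σ) (c : σ → ℝ) :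
    𝔼 x, (∑ S ∈ K, c S * e S x) ^ 2 = ∑ S ∈ K, c S ^ 2 := by
  have : ∀ x, (∑ S ∈ K, c S * e S x) ^ 2
      = ∑ S ∈ K, ∑ T ∈ K, c S * c T * (e S x * e T x) := fun x => by
    rw [sq, sum_mul_sum]
    exact sum_congr rfl fun S _ => sum_congr rfl fun T _ => by ring
  simp only [this, expect_sum_comm, ← mul_expect, he, mul_ite, mul_one, mul_zero, sum_ite_eq]
  exact sum_congr rfl fun S hS => by rw [if_pos hS, sq]

/-- Bessel's inequality. -/
lemma sum_expect_mul_sq_le {Ω σ : Type*} [Fintype Ω] [DecidableEq σ]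
    {e : σ → Ω → ℝ} (he : ∀ S T, 𝔼 x, e S x * e T x = if S = T then 1 else 0)
    (K : Finset σ) (F : Ω → ℝ) :
    ∑ S ∈ K, (𝔼 x, F x * e S x) ^ 2 ≤ 𝔼 x, F x ^ 2 := by
  set c : σ → ℝ := fun S => 𝔼 x, F x * e S x with hc
  have h0 : 0 ≤ 𝔼 x, (F x - ∑ S ∈ K, c S * e S x) ^ 2 := expect_nonneg fun x _ => sq_nonneg _
  have h1 : ∀ x, (F x - ∑ S ∈ K, c S * e S x) ^ 2
      = F x ^ 2 - 2 * ∑ S ∈ K, c S * (F x * e S x) + (∑ S ∈ K, c S * e S x) ^ 2 := fun x => by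
    have : ∑ S ∈ K, c S * (F x * e S x) = F x * ∑ S ∈ K, c S * e S x := by
      rw [mul_sum]
      exact sum_congr rfl fun S _ => by ring
    rw [this]
    ring
  simp only [h1, expect_add_distrib, expect_sub_distrib, ← mul_expect, expect_sum_comm,
    expect_sum_sq_of_orthonormal he] at h0
  have h2 : ∀ S, c S * 𝔼 x, F x * e S x = c S ^ 2 := fun S => (sq _).symm
  simp only [h2] at h0
  linarith

/-- A Fourier coefficient of the likelihood ratio that involves the copy `p₀` and otherwise only
copies in `Q` is a coefficient of the product over `Q` times the centred ratio of `p₀`. -/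
lemma expect_prod_mul_character_eq {R : ι → ι → Prop} (hR : ∀ p q, R p q → r p < r q)
    (hd : ∀ p s s', (∀ q, R q p → s q = s' q) → d p s = d p s')
    (hmean : ∀ p s, 𝔼 v, d p s v = 1) {p₀ : ι} {Q : Finset ι} (hp₀ : p₀ ∉ Q)
    (hQ : ∀ p ∈ Q, ∀ q, R q p → q ∈ Q) (hQ₀ : ∀ q, R q p₀ → q ∈ Q)
    (x : ι → V → ℝ) (hx₀ : 𝔼 v, x p₀ v = 0) (hx : ∀ p, p ≠ p₀ → p ∉ Q → ∀ v, x p v = 1) :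
    𝔼 s, (∏ p, d p s (s p)) * ∏ p, x p (s p)
      = 𝔼 s, ((∏ p ∈ Q, d p s (s p)) * (d p₀ s (s p₀) - 1)) * ∏ p, x p (s p) := by
  have hd' : ∀ p s s', (∀ q, r q < r p → s q = s' q) → d p s = d p s' :=
    fun p s s' h => hd p s s' fun q hq => h q (hR q p hq)
  have hupd : ∀ p ∈ insert p₀ Q, ∀ q ∉ Q, ∀ s v, d p (Function.update s q v) = d p s := by
    intro p hp q hq s v
    refine hd _ _ _ fun a ha => Function.update_of_ne ?_ _ _
    rintro rfl
    rcases mem_insert.1 hp with rfl | hp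
    · exact hq (hQ₀ _ ha)
    · exact hq (hQ p hp _ ha)
  have hmarg := expect_mul_prod_eq hd' hmean (insert p₀ Q)ᶜ
    (fun s => (∏ p ∈ insert p₀ Q, d p s (s p)) * ∏ p, x p (s p)) (by
      intro q hq s v
      rw [mem_compl, mem_insert, not_or] at hq
      congr 1
      · refine prod_congr rfl fun p hp => ?_
        rw [hupd p hp q hq.2, Function.update_of_ne]
        rintro rfl
        exact (mem_insert.1 hp).elim hq.1 hq.2
      · refine prod_congr rfl fun p _ => ?_
        by_cases hpq : p = q
        · subst hpq
          rw [hx p hq.1 hq.2, hx p hq.1 hq.2]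
        · rw [Function.update_of_ne hpq])
  have hzero : 𝔼 s, (∏ p ∈ Q, d p s (s p)) * ∏ p, x p (s p) = 0 := by
    have := expect_mul_apply p₀
      (fun s => (∏ p ∈ Q, d p s (s p)) * ∏ p ∈ univ.erase p₀, x p (s p)) (fun _ => x p₀)
      (fun s v => by
        congr 1
        · refine prod_congr rfl fun p hp => ?_
          rw [hupd p (mem_insert_of_mem hp) p₀ hp₀, Function.update_of_ne
            (ne_of_mem_of_not_mem hp hp₀)]
        · refine prod_congr rfl fun p hp => ?_
          rw [Function.update_of_ne (ne_of_mem_erase hp)])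
      (fun s v => rfl)
    simp only [hx₀, mul_zero, expect_const_zero] at this
    rw [← this]
    refine expect_congr rfl fun s _ => ?_
    rw [← prod_erase_mul univ _ (mem_univ p₀), mul_assoc]
  calc 𝔼 s, (∏ p, d p s (s p)) * ∏ p, x p (s p)
      = 𝔼 s, ((∏ p ∈ insert p₀ Q, d p s (s p)) * ∏ p, x p (s p)) *
          ∏ p ∈ (insert p₀ Q)ᶜ, d p s (s p) := by
        refine expect_congr rfl fun s _ => ?_
        rw [← prod_mul_prod_compl (insert p₀ Q)]
        ring
    _ = 𝔼 s, (∏ p ∈ insert p₀ Q, d p s (s p)) * ∏ p, x p (s p)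
          - 𝔼 s, (∏ p ∈ Q, d p s (s p)) * ∏ p, x p (s p) := by rw [hmarg, hzero, sub_zero]
    _ = _ := by
        rw [← expect_sub_distrib]
        refine expect_congr rfl fun s _ => ?_
        rw [prod_insert hp₀]
        ring

/-- The second moment of the likelihood ratio of at most `L` copies of an adaptive protocol is
bounded by the `2L`-th moments of the adaptive protocols on exactly `L` copies. -/
lemma expect_sum_prod_sq_le {β : Type*} [Nonempty β] {w : J → ℝ} (hw0 : ∀ j, 0 ≤ w j)
    (T : J → β → V → ℝ) (hT : ∀ j φ, 𝔼 v, T j φ v = 1)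
    {L : ℕ} {M : ℝ}
    (hM : ∀ A : Fin L → (Fin L → V) → β,
      (∀ i t t', (∀ i' < i, t i' = t' i') → A i t = A i t') →
      𝔼 t, ∑ j, w j * (∏ i, T j (A i t) (t i)) ^ (2 * L) ≤ M)
    (hr : Function.Injective r) {R : ι → ι → Prop} (hR : ∀ p q, R p q → r p < r q)
    (B : ι → (ι → V) → β) (hB : ∀ p s s', (∀ q, R q p → s q = s' q) → B p s = B p s')
    {Q : Finset ι} (hQ : ∀ p ∈ Q, ∀ q, R q p → q ∈ Q) (hQL : #Q ≤ L) :
    𝔼 s, ∑ j, w j * (∏ p ∈ Q, T j (B p s) (s p)) ^ 2 ≤ M := by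
  obtain ⟨φ₀⟩ := ‹Nonempty β›
  rcases Nat.eq_zero_or_pos L with rfl | hL
  · obtain rfl : Q = ∅ := card_eq_zero.1 (Nat.le_zero.1 hQL)
    simpa [Fintype.expect_const] using hM (fun _ _ => φ₀) fun _ _ _ _ => rfl
  obtain ⟨e, heinj, hemono⟩ := exists_strictMonoOn_rank hr Q hL hQL
  classical
  let A : Fin L → (Fin L → V) → β := fun i t =>
    if h : ∃ p ∈ Q, e p = i then B h.choose (t ∘ e) else φ₀
  have hAe : ∀ p ∈ Q, ∀ t, A (e p) t = B p (t ∘ e) := fun p hp t => by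
    have h : ∃ q ∈ Q, e q = e p := ⟨p, hp, rfl⟩
    simp only [A, dif_pos h]
    rw [heinj h.choose_spec.1 hp h.choose_spec.2]
  have hAdep : ∀ p ∈ Q, ∀ t t' : Fin L → V, (∀ q ∈ Q, R q p → t (e q) = t' (e q)) →
      A (e p) t = A (e p) t' := fun p hp t t' h => by
    rw [hAe p hp, hAe p hp]
    exact hB _ _ _ fun q hq => h q (hQ p hp q hq) hq
  have hA : ∀ i t t', (∀ i' < i, t i' = t' i') → A i t = A i t' := fun i t t' h => by
    by_cases hi : ∃ p ∈ Q, e p = i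
    · obtain ⟨p, hp, rfl⟩ := hi
      exact hAdep p hp t t' fun q hq hqp => h _ (hemono q hq p hp (hR q p hqp))
    · simp only [A, dif_neg hi]
  have hdep : ∀ j (i : Fin L) t t', (∀ i' : Fin L, (i' : ℕ) < i → t i' = t' i') →
      T j (A i t) = T j (A i t') := fun j i t t' h => by rw [hA i t t' h]
  calc 𝔼 s, ∑ j, w j * (∏ p ∈ Q, T j (B p s) (s p)) ^ 2
      = 𝔼 t : Fin L → V, ∑ j, w j * (∏ p ∈ Q, T j (B p (t ∘ e)) ((t ∘ e) p)) ^ 2 := by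
        refine expect_eq_expect_comp_of_injOn heinj _ fun s s' h => ?_
        refine sum_congr rfl fun j _ => ?_
        congr 2
        refine prod_congr rfl fun p hp => ?_
        rw [hB p s s' fun q hq => h q (hQ p hp q hq), h p hp]
    _ = ∑ j, w j * 𝔼 t : Fin L → V, ∏ i ∈ Q.image e, T j (A i t) (t i) ^ 2 := by
        rw [expect_sum_comm]
        refine sum_congr rfl fun j _ => ?_
        rw [mul_expect]
        refine expect_congr rfl fun t _ => ?_
        rw [prod_image heinj, ← prod_pow]
        congr 1
        exact prod_congr rfl fun p hp => by rw [hAe p hp]; rfl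
    _ ≤ ∑ j, w j * 𝔼 t : Fin L → V, (∏ i ∈ Q.image e, T j (A i t) (t i) ^ 2) *
          ∏ i ∈ (Q.image e)ᶜ, T j (A i t) (t i) ^ 2 := by
        refine sum_le_sum fun j _ => mul_le_mul_of_nonneg_left ?_ (hw0 j)
        refine expect_le_expect_mul_prod_sq (r := fun i : Fin L => (i : ℕ)) (hdep j)
          (fun i t => hT j _) _ _ (fun t => prod_nonneg fun i _ => sq_nonneg _) ?_
        intro i hi t v
        rw [mem_compl] at hi
        refine prod_congr rfl fun i' hi' => ?_
        rw [Function.update_of_ne (ne_of_mem_of_not_mem hi' hi)]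
        obtain ⟨p, hp, rfl⟩ := mem_image.1 hi'
        rw [hAdep p hp _ t fun q hq _ => Function.update_of_ne
          (ne_of_mem_of_not_mem (mem_image_of_mem e hq) hi) _ _]
    _ = 𝔼 t : Fin L → V, ∑ j, w j * (∏ i, T j (A i t) (t i)) ^ 2 := by
        rw [expect_sum_comm]
        refine sum_congr rfl fun j _ => ?_
        rw [mul_expect]
        refine expect_congr rfl fun t _ => ?_
        rw [prod_mul_prod_compl, prod_pow]
    _ ≤ 𝔼 t : Fin L → V, ∑ j, w j * (∏ i, T j (A i t) (t i)) ^ (2 * L) := by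
        refine expect_sum_sq_le_expect_sum_pow hw0
          (fun j (t : Fin L → V) => ∏ i, T j (A i t) (t i)) (fun j => ?_) hL.ne'
        have := expect_mul_prod_eq (r := fun i : Fin L => (i : ℕ)) (hdep j)
          (fun i t => hT j _) univ (fun _ => 1) fun _ _ _ _ => rfl
        simpa [Fintype.expect_const] using this
    _ ≤ M := hM A hA

lemma expect_sum_prod_mul_sub_one_sq_le {β : Type*} [Nonempty β] {w : J → ℝ}
    (hw0 : ∀ j, 0 ≤ w j) (hw1 : ∑ j, w j = 1)
    (T : J → β → V → ℝ) (hT : ∀ j φ, 𝔼 v, T j φ v = 1) {L m : ℕ} (hm : m ≠ 0) {M ε : ℝ}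
    (hM : ∀ A : Fin L → (Fin L → V) → β,
      (∀ i t t', (∀ i' < i, t i' = t' i') → A i t = A i t') →
      𝔼 t, ∑ j, w j * (∏ i, T j (A i t) (t i)) ^ (2 * L) ≤ M)
    (hε : ∀ φ, ∑ j, ∑ j', w j * w j' * (𝔼 v, T j φ v * T j' φ v - 1) ^ (2 * m) ≤ ε)
    (hr : Function.Injective r) {R : ι → ι → Prop} (hR : ∀ p q, R p q → r p < r q)
    (B : ι → (ι → V) → β) (hB : ∀ p s s', (∀ q, R q p → s q = s' q) → B p s = B p s')
    {p₀ : ι} {Q : Finset ι} (hp₀ : p₀ ∉ Q) (hQ : ∀ p ∈ Q, ∀ q, R q p → q ∈ Q) (hQL : #Q ≤ L) :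
    𝔼 s, (∑ j, w j * ((∏ p ∈ Q, T j (B p s) (s p)) * (T j (B p₀ s) (s p₀) - 1))) ^ 2
      ≤ ε ^ ((1 : ℝ) / (2 * m : ℕ)) * M := by
  have hε0 : 0 ≤ ε := le_trans (sum_nonneg fun j _ => sum_nonneg fun j' _ =>
    mul_nonneg (mul_nonneg (hw0 j) (hw0 j')) ((even_two_mul m).pow_nonneg _))
    (hε (Classical.arbitrary β))
  have hupd : ∀ p ∈ insert p₀ Q, ∀ s v, B p (Function.update s p₀ v) = B p s := by
    intro p hp s v
    refine hB _ _ _ fun a ha => Function.update_of_ne ?_ _ _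
    rintro rfl
    rcases mem_insert.1 hp with rfl | hp
    · exact lt_irrefl _ (hR _ _ ha)
    · exact hp₀ (hQ p hp _ ha)
  calc _ = 𝔼 s : ι → V, 𝔼 v, (∑ j, w j * (∏ p ∈ Q, T j (B p s) (s p)) *
          (T j (B p₀ s) v - 1)) ^ 2 := by
        rw [expect_eq_expect_update p₀]
        refine expect_congr rfl fun s _ => expect_congr rfl fun v _ => ?_
        congr 1
        refine sum_congr rfl fun j _ => ?_
        rw [mul_assoc, hupd p₀ (mem_insert_self _ _), Function.update_self]
        congr 2
        refine prod_congr rfl fun p hp => ?_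
        rw [hupd p (mem_insert_of_mem hp), Function.update_of_ne (ne_of_mem_of_not_mem hp hp₀)]
    _ ≤ 𝔼 s : ι → V, ε ^ ((1 : ℝ) / (2 * m : ℕ)) *
          ∑ j, w j * (∏ p ∈ Q, T j (B p s) (s p)) ^ 2 :=
        expect_le_expect fun s _ => expect_sum_mul_sub_one_sq_le hw0 hw1 _
          (fun j => T j (B p₀ s)) (fun j => hT j _) hm (hε _)
    _ ≤ _ := by
        rw [← mul_expect]
        exact mul_le_mul_of_nonneg_left (expect_sum_prod_sq_le hw0 T hT hM hr hR B hB hQ hQL)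
          (Real.rpow_nonneg hε0 _)

end Expectation

lemma expect_prod_apply {ι V : Type*} [Fintype ι] [DecidableEq ι] [Fintype V]
    (f : ι → V → ℝ) : 𝔼 s : ι → V, ∏ p, f p (s p) = ∏ p, 𝔼 v, f p v := by
  simp only [Fintype.expect_eq_sum_div_card, prod_div_distrib, Fintype.card_fun, prod_const,
    Fintype.prod_sum, card_univ, Nat.cast_pow]

lemma chiB_eq_prod {n : ℕ} (S : Finset (Fin n)) (v : Fin n → Fin 2) :
    chiB S v = ∏ i, if i ∈ S then (-1 : ℝ) ^ (v i).val else 1 := by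
  rw [chiB, ← prod_pow_eq_pow_sum, prod_ite_mem, univ_inter]

lemma chiB_empty {n : ℕ} (v : Fin n → Fin 2) : chiB ∅ v = 1 := by simp [chiB]

lemma expect_chiB_mul_chiB {n : ℕ} (S T : Finset (Fin n)) :
    𝔼 v, chiB S v * chiB T v = if S = T then 1 else 0 := by
  have h : ∀ i : Fin n, 𝔼 a : Fin 2, (if i ∈ S then (-1 : ℝ) ^ a.val else 1) *
      (if i ∈ T then (-1 : ℝ) ^ a.val else 1) = if (i ∈ S ↔ i ∈ T) then 1 else 0 := fun i => by
    by_cases hS : i ∈ S <;> by_cases hT : i ∈ T <;>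
      simp [hS, hT, Fintype.expect_eq_sum_div_card]
  simp only [chiB_eq_prod, ← prod_mul_distrib]
  rw [expect_prod_apply (fun (i : Fin n) (a : Fin 2) => (if i ∈ S then (-1 : ℝ) ^ a.val else 1) *
      (if i ∈ T then (-1 : ℝ) ^ a.val else 1))]
  simp only [h, Finset.ext_iff, prod_ite_zero, prod_const_one, mem_univ, true_implies]

lemma expect_chiB {n : ℕ} (S : Finset (Fin n)) : 𝔼 v, chiB S v = if S = ∅ then 1 else 0 := by
  simpa [chiB_empty] using expect_chiB_mul_chiB S ∅

lemma expect_prod_chiB_mul {ι : Type*} [Fintype ι] [DecidableEq ι] {n : ℕ}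
    (S T : ι → Finset (Fin n)) :
    𝔼 s : ι → Fin n → Fin 2, (∏ p, chiB (S p) (s p)) * ∏ p, chiB (T p) (s p)
      = if S = T then 1 else 0 := by
  simp only [← prod_mul_distrib]
  rw [expect_prod_apply (fun p v => chiB (S p) v * chiB (T p) v)]
  simp only [expect_chiB_mul_chiB, prod_ite_zero, prod_const_one, mem_univ, true_implies,
    funext_iff]

lemma innerB_eq_expect (n : ℕ) (f g : (Fin n → Fin 2) → ℝ) :
    innerB n f g = 𝔼 v, f v * g v := by
  simp [innerB, Fintype.expect_eq_sum_div_card, div_eq_inv_mul]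

lemma expect_truncD (n D : ℕ) (g : (Fin n → Fin 2) → ℝ) :
    𝔼 v, truncD n D g v = 𝔼 v, g v := by
  simp only [truncD, expect_sum_comm]
  rw [sum_eq_single ∅]
  · simp [innerB_eq_expect, chiB_empty]
  · intro S _ hS
    split_ifs
    · rw [← mul_expect, expect_chiB, if_neg hS, mul_zero]
    · simp
  · simp

lemma sum_star_dotProduct_mulVec {ι : Type*} [Fintype ι] [DecidableEq ι] {φ : ι → ι → ℂ}
    (hφ : IsONB φ) (A : Matrix ι ι ℂ) : ∑ s, star (φ s) ⬝ᵥ (A *ᵥ φ s) = A.trace := by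
  let X : Matrix ι ι ℂ := Matrix.of fun a s => φ s a
  let Y : Matrix ι ι ℂ := Matrix.of fun s a => star (φ s a)
  have hYX : Y * X = 1 := by
    ext s t
    rw [Matrix.one_apply, ← hφ s t]
    rfl
  calc ∑ s, star (φ s) ⬝ᵥ (A *ᵥ φ s) = (Y * (A * X)).trace := rfl
    _ = A.trace := by
      rw [Matrix.trace_mul_comm, Matrix.mul_assoc, mul_eq_one_comm.1 hYX, Matrix.mul_one]

lemma expect_Dbar {n : ℕ} {φ : (Fin n → Fin 2) → (Fin n → Fin 2) → ℂ} (hφ : IsONB φ)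
    {A : Matrix (Fin n → Fin 2) (Fin n → Fin 2) ℂ} (hA : A.trace = 1) :
    𝔼 v, Dbar n φ A v = 1 := by
  have h := congrArg Complex.re (sum_star_dotProduct_mulVec hφ A)
  rw [Complex.re_sum, hA, Complex.one_re] at h
  simp only [Dbar, ← mul_expect]
  rw [Fintype.expect_eq_sum_div_card, h]
  simp

lemma innerBig_eq_expect (n m₀ m₁ : ℕ) (F G : (Fin m₁ → Fin m₀ → Fin n → Fin 2) → ℝ) :
    innerBig n m₀ m₁ F G = 𝔼 s : Fin m₁ × Fin m₀ → Fin n → Fin 2,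
      F (Function.curry s) * G (Function.curry s) := by
  rw [Fintype.expect_equiv (Equiv.curry _ _ _) (fun s => F (Function.curry s) *
    G (Function.curry s)) (fun s => F s * G s) (fun s => rfl)]
  simp [innerBig, Fintype.expect_eq_sum_div_card, div_eq_inv_mul, ← pow_mul, mul_comm,
    mul_left_comm]

lemma chiBig_curry {n m₀ m₁ : ℕ} (S : Fin m₁ × Fin m₀ → Finset (Fin n))
    (s : Fin m₁ × Fin m₀ → Fin n → Fin 2) :
    chiBig (Function.curry S) (Function.curry s) = ∏ p, chiB (S p) (s p) := by
  rw [Fintype.prod_prod_type]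
  rfl

/-- Parseval's identity for the truncation of a function of mean one to few copies. -/
lemma innerBig_truncCopies_sub_one (n m₀ m₁ k : ℕ)
    (F : (Fin m₁ → Fin m₀ → Fin n → Fin 2) → ℝ)
    (hF : 𝔼 s : Fin m₁ × Fin m₀ → Fin n → Fin 2, F (Function.curry s) = 1) :
    innerBig n m₀ m₁ (fun s => truncCopies n m₀ m₁ k F s - 1)
        (fun s => truncCopies n m₀ m₁ k F s - 1)
      = ∑ S : Fin m₁ × Fin m₀ → Finset (Fin n) with (#{p | S p ≠ ∅} ≤ k ∧ S ≠ fun _ => ∅),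
          (𝔼 s, F (Function.curry s) * ∏ p, chiB (S p) (s p)) ^ 2 := by
  have htr : ∀ s, truncCopies n m₀ m₁ k F (Function.curry s)
      = ∑ S : Fin m₁ × Fin m₀ → Finset (Fin n) with #{p | S p ≠ ∅} ≤ k,
        (𝔼 s, F (Function.curry s) * ∏ p, chiB (S p) (s p)) * ∏ p, chiB (S p) (s p) := by
    intro s
    rw [sum_filter, truncCopies]
    refine (Fintype.sum_equiv (Equiv.curry _ _ _) _ _ fun S => ?_).symm
    simp only [Equiv.curry_apply, chiBig_curry, innerBig_eq_expect]
    rfl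
  rw [innerBig_eq_expect, ← expect_sum_sq_of_orthonormal expect_prod_chiB_mul]
  refine expect_congr rfl fun s _ => ?_
  rw [← sq, htr, ← filter_filter, filter_ne', ← sum_erase_add _ _ (a := fun _ => ∅) (by simp)]
  simp [chiB_empty, hF]

/-- A nonempty set of at most `k` copies is covered by a list of `k` blocks, one of which has a
last copy from the set. -/
lemma exists_blocks_of_card_le {α γ : Type*} [Fintype α] [DecidableEq α] [Fintype γ]
    [LinearOrder γ] {k : ℕ} {P : Finset (α × γ)} (hP : P.Nonempty) (hPk : #P ≤ k) :
    ∃ (f : Fin k → α) (i : Fin k) (c : γ), (f i, c) ∈ P ∧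
      ∀ p ∈ P, p.1 ∈ univ.image f ∧ (p.1 = f i → p.2 ≤ c) := by
  classical
  obtain ⟨⟨b, c₁⟩, hb⟩ := hP
  let T := P.image Prod.fst
  have hbT : b ∈ T := mem_image_of_mem _ hb
  have : Nonempty T := ⟨⟨b, hbT⟩⟩
  obtain ⟨e⟩ : Nonempty (T ↪ Fin k) := Function.Embedding.nonempty_of_card_le (by
    simpa using card_image_le.trans hPk)
  have hsurj := Function.invFun_surjective e.injective
  obtain ⟨i, hi⟩ := hsurj ⟨b, hbT⟩
  have hne : ({c | (b, c) ∈ P} : Finset γ).Nonempty := ⟨c₁, by simpa using hb⟩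
  have hmax := max'_mem _ hne
  refine ⟨fun i => (Function.invFun e i).1, i, max' _ hne, ?_, ?_⟩
  · simp only [hi]
    exact (mem_filter.1 hmax).2
  · rintro ⟨b', c'⟩ hp
    obtain ⟨i', hi'⟩ := hsurj ⟨b', mem_image_of_mem _ hp⟩
    refine ⟨mem_image.2 ⟨i', mem_univ _, by rw [hi']⟩, ?_⟩
    simp only [hi]
    rintro rfl
    exact le_max' _ _ (by simpa using hp)

lemma sum_biUnion_le_sum_sum {α σ : Type*} [DecidableEq σ] (s : Finset α) (K : α → Finset σ)
    {f : σ → ℝ} (hf : ∀ S, 0 ≤ f S) : ∑ S ∈ s.biUnion K, f S ≤ ∑ x ∈ s, ∑ S ∈ K x, f S := by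
  classical
  induction s using Finset.induction_on with
  | empty => simp
  | insert a s ha ih =>
    rw [biUnion_insert, sum_insert ha]
    have := sum_union_inter (s₁ := K a) (s₂ := s.biUnion K) (f := f)
    have := sum_nonneg (s := K a ∩ s.biUnion K) fun S _ => hf S
    linarith

/-- low-degree hardness for round-based protocols with adaptivity within
blocks. -/
theorem low_degree_hardness_adaptive_within_blocks
    (n k m₀ m₁ D : ℕ) (hn : 1 ≤ n) (hk : 1 ≤ k) (hm₀ : 1 ≤ m₀) (hm₁ : 1 ≤ m₁)
    (hD : 1 ≤ D) (M ε : ℝ)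
    (J : Type) [Fintype J] (w : J → ℝ) (hw0 : ∀ j, 0 ≤ w j) (hw1 : ∑ j, w j = 1)
    (ρ : J → Matrix (Fin n → Fin 2) (Fin n → Fin 2) ℂ)
    (hρ : ∀ j, (ρ j).PosSemidef) (htrρ : ∀ j, (ρ j).trace = 1)
    (hM : ∀ A : Fin (k * m₀ - 1) →
        (Fin (k * m₀ - 1) → Fin n → Fin 2) →
        ((Fin n → Fin 2) → (Fin n → Fin 2) → ℂ),
      (∀ i h, IsONB (A i h)) →
      (∀ i h h', (∀ i' : Fin (k * m₀ - 1), i' < i → h i' = h' i') → A i h = A i h') →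
      ((2 : ℝ) ^ ((k * m₀ - 1) * n))⁻¹ *
          ∑ s : Fin (k * m₀ - 1) → Fin n → Fin 2,
            ∑ j, w j *
              (∏ i, truncD n D (Dbar n (A i s) (ρ j)) (s i)) ^ (2 * (k * m₀ - 1)) ≤ M)
    (hε : ∀ φ₀ : (Fin n → Fin 2) → (Fin n → Fin 2) → ℂ, IsONB φ₀ →
      ∑ j, ∑ j', w j * w j' *
          (innerB n (truncD n D (Dbar n φ₀ (ρ j)))
              (truncD n D (Dbar n φ₀ (ρ j'))) - 1) ^ (2 * k * m₀) ≤ ε)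
    (Bas : Fin m₁ → Fin m₀ → (Fin m₀ → Fin n → Fin 2) →
      ((Fin n → Fin 2) → (Fin n → Fin 2) → ℂ))
    (hBasONB : ∀ b j h, IsONB (Bas b j h))
    (hBasAdapt : ∀ b j h h', (∀ j' : Fin m₀, j' < j → h j' = h' j') →
      Bas b j h = Bas b j h') :
    innerBig n m₀ m₁
        (fun s => truncCopies n m₀ m₁ k
            (fun s' => ∑ j, w j *
              ∏ b, ∏ c, truncD n D (Dbar n (Bas b c (s' b)) (ρ j)) (s' b c)) s - 1)
        (fun s => truncCopies n m₀ m₁ k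
            (fun s' => ∑ j, w j *
              ∏ b, ∏ c, truncD n D (Dbar n (Bas b c (s' b)) (ρ j)) (s' b c)) s - 1)
      ≤ (k : ℝ) ^ 3 * 2 ^ k * (m₁ : ℝ) ^ k * ((k * m₀ : ℕ) : ℝ) ^ (k ^ 2) *
          ε ^ ((1 : ℝ) / (2 * (k : ℝ) * (m₀ : ℝ))) * M := by
  classical
  let β := {φ : (Fin n → Fin 2) → (Fin n → Fin 2) → ℂ // IsONB φ}
  let T : J → β → (Fin n → Fin 2) → ℝ := fun j φ => truncD n D (Dbar n φ.1 (ρ j))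
  have hT : ∀ j φ, 𝔼 v, T j φ v = 1 := fun j φ => by
    rw [expect_truncD, expect_Dbar φ.2 (htrρ j)]
  let B : Fin m₁ × Fin m₀ → (Fin m₁ × Fin m₀ → Fin n → Fin 2) → β := fun p s =>
    ⟨Bas p.1 p.2 (Function.curry s p.1), hBasONB _ _ _⟩
  let R : Fin m₁ × Fin m₀ → Fin m₁ × Fin m₀ → Prop := fun q p => q.1 = p.1 ∧ q.2 < p.2
  let r : Fin m₁ × Fin m₀ → ℕ := fun p => finProdFinEquiv p
  have hr : Function.Injective r := Fin.val_injective.comp finProdFinEquiv.injective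
  have hR : ∀ p q, R p q → r p < r q := by
    rintro ⟨b, c⟩ ⟨b', c'⟩ ⟨h, hlt⟩
    obtain rfl : b = b' := h
    simpa [r, finProdFinEquiv] using hlt
  have hB : ∀ p s s', (∀ q, R q p → s q = s' q) → B p s = B p s' := fun p s s' h =>
    Subtype.ext (hBasAdapt _ _ _ _ fun c hc => h (p.1, c) ⟨rfl, hc⟩)
  have : Nonempty β := ⟨B (⟨0, hm₁⟩, ⟨0, hm₀⟩) fun _ _ => 0⟩
  have hkm : k * m₀ ≠ 0 := (Nat.mul_pos hk hm₀).ne'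
  have hM' : ∀ A : Fin (k * m₀ - 1) → (Fin (k * m₀ - 1) → Fin n → Fin 2) → β,
      (∀ i t t', (∀ i' < i, t i' = t' i') → A i t = A i t') →
      𝔼 t, ∑ j, w j * (∏ i, T j (A i t) (t i)) ^ (2 * (k * m₀ - 1)) ≤ M := fun A hA => by
    refine le_trans (le_of_eq ?_) (hM (fun i t => (A i t).1) (fun i t => (A i t).2)
      fun i t t' h => congrArg Subtype.val (hA i t t' h))
    simp [T, Fintype.expect_eq_sum_div_card, div_eq_inv_mul, ← pow_mul, mul_comm]
  have hε' : ∀ φ, ∑ j, ∑ j', w j * w j' * (𝔼 v, T j φ v * T j' φ v - 1) ^ (2 * (k * m₀)) ≤ ε :=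
    fun φ => by
      simp only [← innerB_eq_expect, ← mul_assoc]
      exact hε φ.1 φ.2
  let F : (Fin m₁ → Fin m₀ → Fin n → Fin 2) → ℝ := fun s => ∑ j, w j *
    ∏ b, ∏ c, truncD n D (Dbar n (Bas b c (s b)) (ρ j)) (s b c)
  have hF : ∀ s, F (Function.curry s) = ∑ j, w j * ∏ p, T j (B p s) (s p) := fun s => by
    simp only [F, T, B, Fintype.prod_prod_type]
    rfl
  have hd : ∀ j p s s', (∀ q, R q p → s q = s' q) → T j (B p s) = T j (B p s') :=
    fun j p s s' h => by rw [hB p s s' h]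
  have hF1 : 𝔼 s : Fin m₁ × Fin m₀ → Fin n → Fin 2, F (Function.curry s) = 1 := by
    simp only [hF, expect_sum_comm, ← mul_expect]
    rw [← hw1]
    refine sum_congr rfl fun j _ => ?_
    have := expect_mul_prod_eq (r := r) (d := fun p s => T j (B p s))
      (fun p s s' h => hd j p s s' fun q hq => h q (hR q p hq)) (fun p s => hT j _) univ
      (fun _ => 1) fun _ _ _ _ => rfl
    simp only [one_mul, Fintype.expect_const] at this
    rw [this, mul_one]
  rw [show (fun s' => ∑ j, w j * ∏ b, ∏ c,
      truncD n D (Dbar n (Bas b c (s' b)) (ρ j)) (s' b c)) = F from rfl,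
    innerBig_truncCopies_sub_one n m₀ m₁ k F hF1]
  let Q : (Fin k → Fin m₁) × Fin k × Fin m₀ → Finset (Fin m₁ × Fin m₀) := fun x =>
    {p | p.1 ∈ univ.image x.1 ∧ (p.1 = x.1 x.2.1 → p.2 < x.2.2)}
  let p₀ : (Fin k → Fin m₁) × Fin k × Fin m₀ → Fin m₁ × Fin m₀ := fun x => (x.1 x.2.1, x.2.2)
  have hp₀ : ∀ x, p₀ x ∉ Q x := fun x h => lt_irrefl _ ((mem_filter.1 h).2.2 rfl)
  have hQ : ∀ x, ∀ p ∈ Q x, ∀ q, R q p → q ∈ Q x := fun x p hp q hqp => by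
    simp only [Q, mem_filter, mem_univ, true_and] at hp ⊢
    exact ⟨hqp.1 ▸ hp.1, fun h => hqp.2.trans (hp.2 (hqp.1 ▸ h))⟩
  have hQ₀ : ∀ x q, R q (p₀ x) → q ∈ Q x := fun x q hq => by
    simp only [Q, mem_filter, mem_univ, true_and]
    exact ⟨hq.1 ▸ mem_image_of_mem _ (mem_univ _), fun _ => hq.2⟩
  have hQL : ∀ x, #(Q x) ≤ k * m₀ - 1 := fun x => by
    have hsub : insert (p₀ x) (Q x) ⊆ univ.image x.1 ×ˢ univ := by
      refine insert_subset (by simp [p₀]) fun p hp => ?_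
      rw [mem_product]
      exact ⟨(mem_filter.1 hp).2.1, mem_univ _⟩
    have h1 := card_le_card hsub
    rw [card_insert_of_notMem (hp₀ x), card_product, card_univ, Fintype.card_fin] at h1
    have h2 : #(univ.image x.1) ≤ k := card_image_le.trans (by simp)
    have h3 := Nat.mul_le_mul_right m₀ h2
    omega
  let K : (Fin k → Fin m₁) × Fin k × Fin m₀ → Finset (Fin m₁ × Fin m₀ → Finset (Fin n)) :=
    fun x => {S | S (p₀ x) ≠ ∅ ∧ ∀ p, p ≠ p₀ x → p ∉ Q x → S p = ∅}
  let G : (Fin k → Fin m₁) × Fin k × Fin m₀ → (Fin m₁ × Fin m₀ → Fin n → Fin 2) → ℝ :=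
    fun x s => ∑ j, w j * ((∏ p ∈ Q x, T j (B p s) (s p)) * (T j (B (p₀ x) s) (s (p₀ x)) - 1))
  have hcoef : ∀ x, ∀ S ∈ K x, 𝔼 s, F (Function.curry s) * ∏ p, chiB (S p) (s p)
      = 𝔼 s, G x s * ∏ p, chiB (S p) (s p) := fun x S hS => by
    rw [mem_filter] at hS
    simp only [hF, G, sum_mul, expect_sum_comm]
    refine sum_congr rfl fun j _ => ?_
    have := expect_prod_mul_character_eq (d := fun p s => T j (B p s)) hR (hd j)
      (fun p s => hT j _) (hp₀ x) (hQ x) (hQ₀ x) (fun p => chiB (S p))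
      (by rw [expect_chiB, if_neg hS.2.1])
      (fun p h1 h2 v => by rw [hS.2.2 p h1 h2, chiB_empty])
    simp only [mul_assoc (w j), ← mul_expect, this]
  set E := ε ^ ((1 : ℝ) / (2 * (k : ℝ) * (m₀ : ℝ))) with hE
  have hG : ∀ x, 𝔼 s, G x s ^ 2 ≤ E * M := fun x => by
    have := expect_sum_prod_mul_sub_one_sq_le hw0 hw1 T hT hkm hM' hε' hr hR B hB (hp₀ x) (hQ x)
      (hQL x)
    rwa [← mul_assoc, Nat.cast_mul, Nat.cast_mul, Nat.cast_ofNat, ← hE] at this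
  have hEM : 0 ≤ E * M := (expect_nonneg fun s _ => sq_nonneg _).trans
    (hG (fun _ => ⟨0, hm₁⟩, ⟨0, hk⟩, ⟨0, hm₀⟩))
  calc _ ≤ ∑ S ∈ univ.biUnion K, (𝔼 s, F (Function.curry s) * ∏ p, chiB (S p) (s p)) ^ 2 := by
        refine sum_le_sum_of_subset_of_nonneg (fun S hS => ?_) fun _ _ _ => sq_nonneg _
        obtain ⟨-, hSk, hS0⟩ := mem_filter.1 hS
        have hne : ({p | S p ≠ ∅} : Finset (Fin m₁ × Fin m₀)).Nonempty := by
          obtain ⟨p, hp⟩ := Function.ne_iff.1 hS0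
          exact ⟨p, by simpa using hp⟩
        obtain ⟨f, i, c, hmem, hcov⟩ := exists_blocks_of_card_le hne hSk
        refine mem_biUnion.2 ⟨(f, i, c), mem_univ _, mem_filter.2 ⟨mem_univ _, ?_, ?_⟩⟩
        · exact (mem_filter.1 hmem).2
        · intro p hp hpQ
          by_contra hSp
          obtain ⟨h1, h2⟩ := hcov p (mem_filter.2 ⟨mem_univ _, hSp⟩)
          refine hpQ (mem_filter.2 ⟨mem_univ _, h1, fun h => (h2 h).lt_of_ne fun h' => ?_⟩)
          exact hp (Prod.ext h h')
    _ ≤ ∑ x, ∑ S ∈ K x, (𝔼 s, F (Function.curry s) * ∏ p, chiB (S p) (s p)) ^ 2 :=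
        sum_biUnion_le_sum_sum _ _ fun _ => sq_nonneg _
    _ ≤ ∑ _x : (Fin k → Fin m₁) × Fin k × Fin m₀, E * M := by
        refine sum_le_sum fun x _ => le_trans (le_of_eq ?_)
          ((sum_expect_mul_sq_le expect_prod_chiB_mul (K x) (G x)).trans (hG x))
        exact sum_congr rfl fun S hS => by rw [hcoef x S hS]
    _ = (k * (1 : ℝ) * (m₁ : ℝ) ^ k * m₀) * (E * M) := by
        rw [sum_const, card_univ, Fintype.card_prod, Fintype.card_prod, Fintype.card_fun,
          nsmul_eq_mul]
        simp only [Fintype.card_fin]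
        push_cast
        ring
    _ ≤ (k : ℝ) ^ 3 * 2 ^ k * (m₁ : ℝ) ^ k * ((k * m₀ : ℕ) : ℝ) ^ (k ^ 2) * (E * M) := by
        have hk1 : (1 : ℝ) ≤ k := by exact_mod_cast hk
        have hm : m₀ ≤ (k * m₀) ^ (k ^ 2) := (Nat.le_mul_of_pos_left _ hk).trans
          (Nat.le_self_pow (pow_pos hk 2).ne' _)
        have hm' : (m₀ : ℝ) ≤ ((k * m₀ : ℕ) : ℝ) ^ (k ^ 2) := by exact_mod_cast hm
        have h3 : (k : ℝ) ≤ (k : ℝ) ^ 3 := le_self_pow₀ hk1 (by norm_num)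
        have h2 : (1 : ℝ) ≤ 2 ^ k := one_le_pow₀ (by norm_num)
        gcongr
    _ = _ := by ring
end

section
/- Low-degree Fourier mass bound for quantum planted biclique under local measurements: there exist absolute constants C, c > 0 with the following property. Let d, n, m, k ≥ 1 with k³ ≤ c·√d, let 0 ≤ λ ≤ n and κ = λ/n, let ν be an exact state k-design on ℂ^d, and for each (i,j) ∈ [m]×[n] let (ψ^{i,j}_x)_{x∈[d]} be an orthonormal basis of ℂ^d. For a unit vector ψ ∈ ℂ^d and S ⊆ [n], let σ_{ψψ^*,S} = κ·⊗_{i=1}^n(I/d + 1[i∈S]·(ψψ^* − I/d)) + (1−κ)·(I/d)^{⊗n}, let S be a random subset of [n] containing each element independently with probability κ, and define the averaged likelihood ratio D̄(x) = d^{mn} · E_{ψ∼ν} E_S [ ⟨Ψ_x, σ_{ψψ^*,S}^{⊗m} Ψ_x⟩ ] for x ∈ [d]^{[m]×[n]}, where Ψ_x = ⊗_{(i,j)} ψ^{i,j}_{x_{i,j}}. Let ξ = e^{2πi/d}, and for W ⊆ [m]×[n] and α: W → {1,…,d−1} define D̂[(W,α)] = E_{x ∼ Uniform([d]^{[m]×[n]})}[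 D̄(x) · ∏_{(i,j)∈W} ξ^{α_{i,j}·x_{i,j}} ]. Then Σ_{W: 1 ≤ |W| ≤ k} Σ_{α: W→{1,…,d−1}} |D̂[(W,α)]|² ≤ ( Σ_{t=1}^{k} ( C·k³·m·λ² / (n²·√d) )^t ) · ( Σ_{s=1}^{k} (λ²/n)^s ). -/
open Matrix BigOperators Finset
open scoped ComplexOrder

/-- The rank-one projector `ψψ^*` onto the vector `ψ`. -/
noncomputable def projVec {ι : Type*} (ψ : ι → ℂ) : Matrix ι ι ℂ :=
  Matrix.vecMulVec ψ (star ψ)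

/-- The `u`-fold tensor power `M^{⊗u}` of a `d × d` matrix. -/
noncomputable def tpow {d : ℕ} (u : ℕ) (M : Matrix (Fin d) (Fin d) ℂ) :
    Matrix (Fin u → Fin d) (Fin u → Fin d) ℂ :=
  Matrix.of fun f g => ∏ ℓ : Fin u, M (f ℓ) (g ℓ)

/-- The operator permuting the tensor factors of `(ℂ^d)^{⊗u}` according to `π`. -/
noncomputable def permMat {d u : ℕ} (π : Equiv.Perm (Fin u)) :
    Matrix (Fin u → Fin d) (Fin u → Fin d) ℂ :=
  Matrix.of fun f g => if ∀ ℓ, f (π ℓ) = g ℓ then 1 else 0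

/-- The `(x,y)` entry of the maximally mixed state `I/d` on `ℂ^d`. -/
noncomputable def mmEntry (d : ℕ) (x y : Fin d) : ℂ :=
  if x = y then (d : ℂ)⁻¹ else 0

/-- The quantum planted biclique state `σ_{ρ,S} = κ·⊗_{i=1}^n (I/d + 1[i∈S]·(ρ − I/d))
+ (1−κ)·(I/d)^{⊗n}`. -/
noncomputable def sigmaPB {d n : ℕ} (κ : ℝ) (ρ : Matrix (Fin d) (Fin d) ℂ)
    (S : Finset (Fin n)) :
    Matrix (Fin n → Fin d) (Fin n → Fin d) ℂ :=
  Matrix.of fun a a' =>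
    (κ : ℂ) * (∏ i : Fin n,
        (mmEntry d (a i) (a' i) +
          if i ∈ S then ρ (a i) (a' i) - mmEntry d (a i) (a' i) else 0))
      + ((1 - κ : ℝ) : ℂ) * ∏ i : Fin n, mmEntry d (a i) (a' i)

/-- The `m`-fold tensor power of an operator on `(ℂ^d)^{⊗n}`. -/
noncomputable def cpow {d n : ℕ} (m : ℕ)
    (M : Matrix (Fin n → Fin d) (Fin n → Fin d) ℂ) :
    Matrix (Fin m × Fin n → Fin d) (Fin m × Fin n → Fin d) ℂ :=
  Matrix.of fun f g => ∏ ℓ : Fin m, M (fun i => f (ℓ, i)) (fun i => g (ℓ, i))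

/-- The product vector `Ψ_x = ⊗_{(i,j)} ψ^{i,j}_{x_{i,j}}`. -/
noncomputable def prodVec {d n m : ℕ} (ψb : Fin m × Fin n → Fin d → Fin d → ℂ)
    (x : Fin m × Fin n → Fin d) : (Fin m × Fin n → Fin d) → ℂ :=
  fun f => ∏ p, ψb p (x p) (f p)

/-- The averaged likelihood ratio `D̄(x)` of the quantum planted biclique readouts
against the uniform distribution on `[d]^{[m]×[n]}`. -/
noncomputable def bicliqueLR (d n m : ℕ) (κ : ℝ) {J : Type} [Fintype J]
    (w : J → ℝ) (ψ : J → Fin d → ℂ)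
    (ψb : Fin m × Fin n → Fin d → Fin d → ℂ) (x : Fin m × Fin n → Fin d) : ℝ :=
  (d : ℝ) ^ (m * n) * ∑ j, w j * ∑ S : Finset (Fin n),
    κ ^ S.card * (1 - κ) ^ (n - S.card) *
      (star (prodVec ψb x) ⬝ᵥ
        (cpow m (sigmaPB κ (projVec (ψ j)) S) *ᵥ prodVec ψb x)).re

/-- The Fourier coefficient `D̂[(W,α)]` of the averaged likelihood ratio with respect to
the harmonic characters of `ℤ_d^{[m]×[n]}`. -/
noncomputable def bicliqueFourier (d n m : ℕ) (κ : ℝ) {J : Type} [Fintype J]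
    (w : J → ℝ) (ψ : J → Fin d → ℂ)
    (ψb : Fin m × Fin n → Fin d → Fin d → ℂ)
    (W : Finset (Fin m × Fin n)) (α : {p // p ∈ W} → Fin (d - 1)) : ℂ :=
  ((d : ℂ) ^ (m * n))⁻¹ * ∑ x : Fin m × Fin n → Fin d,
    (bicliqueLR d n m κ w ψ ψb x : ℂ) *
      ∏ p : {p // p ∈ W},
        Complex.exp (2 * Real.pi * Complex.I / d) ^ (((α p : ℕ) + 1) * ((x p.val : ℕ)))


theorem sum_sum_update {P β M : Type*} [Fintype P] [DecidableEq P] [Fintype β]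
    [AddCommMonoid M] (p : P) (F : (P → β) → M) :
    ∑ x, ∑ a, F (Function.update x p a) = Fintype.card β • ∑ x, F x := by
  have hinv : Function.Involutive
      (fun z : (P → β) × β => (Function.update z.1 p z.2, z.1 p)) := by
    rintro ⟨x, a⟩
    simp
  have h := Equiv.sum_comp hinv.toPerm (fun z : (P → β) × β => F z.1)
  rw [Fintype.sum_prod_type, Fintype.sum_prod_type] at h
  simpa [Finset.smul_sum] using h

namespace IsONB

variable {ι : Type*} [Fintype ι] [DecidableEq ι]

theorem sum_mul {φ : ι → ι → ℂ} (h : IsONB φ) (v : ι → ℂ) :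
    ∑ y, (star v ⬝ᵥ φ y) * (star (φ y) ⬝ᵥ v) = star v ⬝ᵥ v := by
  let M : Matrix ι ι ℂ := Matrix.of fun y a => star (φ y a)
  have h1 : M * Mᴴ = 1 := by
    ext s t
    have := h s t
    simpa [M, Matrix.mul_apply, dotProduct, Matrix.one_apply] using this
  have h2 : Mᴴ * M = 1 := mul_eq_one_comm.mp h1
  have h3 : ∀ y, star (φ y) ⬝ᵥ v = (M *ᵥ v) y := fun y => rfl
  have h4 : ∀ y, star v ⬝ᵥ φ y = star ((M *ᵥ v) y) := by
    intro y
    rw [← h3, ← Matrix.star_dotProduct]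
  calc _ = star (M *ᵥ v) ⬝ᵥ (M *ᵥ v) := by
        simp only [h3, h4]; rfl
    _ = star v ⬝ᵥ v := by
        rw [Matrix.star_mulVec, Matrix.dotProduct_mulVec, Matrix.vecMul_vecMul, h2,
          Matrix.vecMul_one]

theorem sum_normSq {φ : ι → ι → ℂ} (h : IsONB φ) {v : ι → ℂ} (hv : star v ⬝ᵥ v = 1) :
    ∑ y, Complex.normSq (star (φ y) ⬝ᵥ v) = 1 := by
  have := h.sum_mul v
  rw [hv] at this
  have h4 : ∀ y, star v ⬝ᵥ φ y = star (star (φ y) ⬝ᵥ v) := fun y =>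
    Matrix.star_dotProduct v (φ y)
  have h5 : ∀ y, (star v ⬝ᵥ φ y) * (star (φ y) ⬝ᵥ v) =
      (Complex.normSq (star (φ y) ⬝ᵥ v) : ℂ) := by
    intro y
    rw [h4, mul_comm, ← Complex.mul_conj]; rfl
  simp only [h5] at this
  exact_mod_cast this

end IsONB

theorem sum_exp_mul {d : ℕ} (a b : Fin d) :
    ∑ y : Fin d, star (Complex.exp (2 * Real.pi * Complex.I / d) ^ ((y : ℕ) * a)) *
      Complex.exp (2 * Real.pi * Complex.I / d) ^ ((y : ℕ) * b) = if a = b then (d : ℂ) else 0 := by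
  have hd : d ≠ 0 := by have := a.2; omega
  have hp := Complex.isPrimitiveRoot_exp d hd
  set ξ := Complex.exp (2 * Real.pi * Complex.I / d) with hξ
  have hstar : star ξ = ξ⁻¹ := by
    have hn : ‖ξ‖ = 1 := hp.norm'_eq_one hd
    rw [Complex.inv_def, Complex.normSq_eq_norm_sq, hn]; simp
  have h0 : ξ ≠ 0 := hp.ne_zero hd
  have key : ∀ y : Fin d, star (ξ ^ ((y : ℕ) * a)) * ξ ^ ((y : ℕ) * b) =
      ((ξ ^ (a : ℕ))⁻¹ * ξ ^ (b : ℕ)) ^ (y : ℕ) := by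
    intro y
    rw [star_pow, hstar, mul_pow, inv_pow, inv_pow, ← pow_mul, ← pow_mul, mul_comm (a : ℕ),
      mul_comm (b : ℕ)]
  simp only [key]
  rw [Fin.sum_univ_eq_sum_range (fun y => ((ξ ^ (a : ℕ))⁻¹ * ξ ^ (b : ℕ)) ^ y) d]
  split_ifs with h
  · subst h
    simp [h0]
  · have hne : (ξ ^ (a : ℕ))⁻¹ * ξ ^ (b : ℕ) ≠ 1 := by
      intro H
      apply h
      apply Fin.ext
      apply hp.pow_inj a.2 b.2
      field_simp at H
      exact H.symm
    have hz : ((ξ ^ (a : ℕ))⁻¹ * ξ ^ (b : ℕ)) ^ d = 1 := by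
      rw [mul_pow, inv_pow, ← pow_mul, ← pow_mul, mul_comm (a : ℕ), mul_comm (b : ℕ), pow_mul,
        pow_mul, hp.pow_eq_one]
      simp
    have := geom_sum_eq hne d
    rw [this, hz]; simp

theorem sum_exp_succ {d : ℕ} (a : Fin (d - 1)) :
    ∑ y : Fin d, Complex.exp (2 * Real.pi * Complex.I / d) ^ (((a : ℕ) + 1) * (y : ℕ)) = 0 := by
  have := a.2
  have h := sum_exp_mul (d := d) ⟨0, by omega⟩ ⟨a + 1, by omega⟩
  rw [if_neg (by simp)] at h
  simpa [mul_comm] using h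

/-- The primitive `d`-th root of unity `e^{2πi/d}`. -/
noncomputable abbrev zetaRoot (d : ℕ) : ℂ := Complex.exp (2 * Real.pi * Complex.I / d)

theorem star_dotProduct_self_eq {ι : Type*} [Fintype ι] (v : ι → ℂ) :
    star v ⬝ᵥ v = ((∑ x, ‖v x‖ ^ 2 : ℝ) : ℂ) := by
  simp [dotProduct, Complex.conj_mul']

theorem sum_normSq_mulVec_of_scaled_isometry {ι κ : Type*} [Fintype ι] [Fintype κ] [DecidableEq κ]
    (F : Matrix ι κ ℂ) (c : ℝ) (hF : Fᴴ * F = (c : ℂ) • 1) (H : κ → ℂ) :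
    ∑ i, ‖(F *ᵥ H) i‖ ^ 2 = c * ∑ x, ‖H x‖ ^ 2 := by
  have h1 : star (F *ᵥ H) ⬝ᵥ (F *ᵥ H) = (c : ℂ) * (star H ⬝ᵥ H) := by
    rw [Matrix.star_mulVec, Matrix.dotProduct_mulVec, Matrix.vecMul_vecMul, hF,
      ← Matrix.dotProduct_mulVec, Matrix.smul_mulVec, Matrix.one_mulVec, dotProduct_smul,
      smul_eq_mul]
  rw [star_dotProduct_self_eq, star_dotProduct_self_eq] at h1
  exact_mod_cast h1

theorem sum_norm_fourier_le {P : Type*} [Fintype P] [DecidableEq P] {d : ℕ}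
    (H : (P → Fin d) → ℂ) :
    ∑ α : P → Fin (d - 1),
        ‖∑ x : P → Fin d, (∏ p, zetaRoot d ^ (((α p : ℕ) + 1) * (x p : ℕ))) * H x‖ ^ 2
      ≤ (d : ℝ) ^ Fintype.card P * ∑ x, ‖H x‖ ^ 2 := by
  let F : Matrix (P → Fin d) (P → Fin d) ℂ :=
    Matrix.of fun β x => ∏ p, zetaRoot d ^ ((β p : ℕ) * (x p : ℕ))
  have hF : Fᴴ * F = (((d : ℝ) ^ Fintype.card P : ℝ) : ℂ) • 1 := by
    ext x y
    simp only [F, Matrix.mul_apply, Matrix.conjTranspose_apply, Matrix.of_apply, star_prod,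
      ← Finset.prod_mul_distrib]
    rw [← Fintype.prod_sum
      (fun p (b : Fin d) => star (zetaRoot d ^ ((b : ℕ) * (x p : ℕ))) *
        zetaRoot d ^ ((b : ℕ) * (y p : ℕ)))]
    simp only [sum_exp_mul]
    rw [Finset.prod_ite_zero]
    simp [Matrix.one_apply, funext_iff]
  rw [← sum_normSq_mulVec_of_scaled_isometry F _ hF H]
  let g : (P → Fin (d - 1)) → P → Fin d := fun α p => ⟨α p + 1, by have := (α p).2; omega⟩
  have hg : Function.Injective g := by
    intro α β h
    funext p
    have := congrFun h p
    simp only [g, Fin.mk.injEq] at this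
    exact Fin.ext (by omega)
  have h1 := Finset.sum_le_sum_of_subset_of_nonneg (Finset.subset_univ (Finset.univ.image g))
    (f := fun β => ‖(F *ᵥ H) β‖ ^ 2) (fun i _ _ => by positivity)
  rw [Finset.sum_image (fun _ _ _ _ h => hg h)] at h1
  exact h1

theorem sum_moment_fin {d u : ℕ} {J : Type*} [Fintype J] (w : J → ℝ) (ψ : J → Fin d → ℂ) (K : ℂ)
    (hdes : ∑ j, (w j : ℂ) • tpow u (projVec (ψ j)) = K • ∑ π : Equiv.Perm (Fin u), permMat π)
    (φ : Fin u → Fin d → ℂ) :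
    ∑ j, (w j : ℂ) * ∏ p, (Complex.normSq (star (φ p) ⬝ᵥ ψ j) : ℂ) =
      K * ∑ π : Equiv.Perm (Fin u), ∏ p, star (φ p) ⬝ᵥ φ (π p) := by
  have h1 : ∀ v : Fin d → ℂ, ∏ p, (Complex.normSq (star (φ p) ⬝ᵥ v) : ℂ) =
      ∑ f : Fin u → Fin d, ∑ g : Fin u → Fin d,
        (∏ p, star (φ p (f p)) * φ p (g p)) * tpow u (projVec v) f g := by
    intro v
    have h : ∀ p, (Complex.normSq (star (φ p) ⬝ᵥ v) : ℂ) =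
        ∑ a, ∑ b, star (φ p a) * φ p b * projVec v a b := by
      intro p
      rw [← Complex.mul_conj, starRingEnd_apply, ← Matrix.star_dotProduct]
      simp only [dotProduct, Finset.sum_mul_sum, projVec, Matrix.vecMulVec_apply, Pi.star_apply]
      exact Finset.sum_congr rfl fun a _ => Finset.sum_congr rfl fun b _ => by ring
    simp only [h]
    rw [Fintype.prod_sum]
    refine Finset.sum_congr rfl fun f _ => ?_
    rw [Fintype.prod_sum]
    refine Finset.sum_congr rfl fun g _ => ?_
    rw [Finset.prod_mul_distrib]
    rfl
  have h2 : ∀ f g, ∑ j, (w j : ℂ) * tpow u (projVec (ψ j)) f g =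
      K * ∑ π : Equiv.Perm (Fin u), permMat π f g := by
    intro f g
    have := congrFun (congrFun hdes f) g
    simpa [Matrix.sum_apply] using this
  calc _ = ∑ f : Fin u → Fin d, ∑ g : Fin u → Fin d,
        (∏ p, star (φ p (f p)) * φ p (g p)) * ∑ j, (w j : ℂ) * tpow u (projVec (ψ j)) f g := by
        simp only [h1, Finset.mul_sum]
        rw [Finset.sum_comm]
        refine Finset.sum_congr rfl fun f _ => ?_
        rw [Finset.sum_comm]
        exact Finset.sum_congr rfl fun g _ => Finset.sum_congr rfl fun j _ => by ring
    _ = K * ∑ π : Equiv.Perm (Fin u), ∑ f : Fin u → Fin d,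
          ∏ p, star (φ p (f p)) * φ p (f (π p)) := by
        have h3 : ∀ (π : Equiv.Perm (Fin u)) (f : Fin u → Fin d),
            ∑ g : Fin u → Fin d, (∏ p, star (φ p (f p)) * φ p (g p)) * permMat π f g =
              ∏ p, star (φ p (f p)) * φ p (f (π p)) := by
          intro π f
          rw [Finset.sum_eq_single (f ∘ π)]
          · simp [permMat]
          · intro g _ hg
            have : ¬ ∀ ℓ, f (π ℓ) = g ℓ := fun H => hg (funext fun ℓ => (H ℓ).symm)
            simp [permMat, this]
          · simp
        simp only [h2, ← h3]
        conv_rhs => rw [Finset.sum_comm, Finset.mul_sum]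
        refine Finset.sum_congr rfl fun f _ => ?_
        conv_rhs => rw [Finset.sum_comm, Finset.mul_sum]
        refine Finset.sum_congr rfl fun g _ => ?_
        rw [← Finset.mul_sum]
        ring
    _ = K * ∑ π : Equiv.Perm (Fin u), ∑ f : Fin u → Fin d,
          ∏ p, star (φ p (f p)) * φ (π⁻¹ p) (f p) := by
        congr 1
        refine Finset.sum_congr rfl fun π _ => Finset.sum_congr rfl fun f _ => ?_
        rw [Finset.prod_mul_distrib, Finset.prod_mul_distrib]
        congr 1
        rw [← Equiv.prod_comp π (fun p => φ (π⁻¹ p) (f p))]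
        simp
    _ = _ := by
        rw [← Equiv.sum_comp (Equiv.inv (Equiv.Perm (Fin u)))
          (fun π => ∏ p, star (φ p) ⬝ᵥ φ (π p))]
        congr 1
        refine Finset.sum_congr rfl fun π _ => ?_
        simp only [dotProduct, Equiv.inv_apply]
        rw [Fintype.prod_sum]
        rfl

theorem sum_moment {P : Type*} [Fintype P] [DecidableEq P] {d : ℕ} {J : Type*} [Fintype J]
    (w : J → ℝ) (ψ : J → Fin d → ℂ) (K : ℂ)
    (hdes : ∑ j, (w j : ℂ) • tpow (Fintype.card P) (projVec (ψ j)) =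
      K • ∑ π : Equiv.Perm (Fin (Fintype.card P)), permMat π)
    (φ : P → Fin d → ℂ) :
    ∑ j, (w j : ℂ) * ∏ p, (Complex.normSq (star (φ p) ⬝ᵥ ψ j) : ℂ) =
      K * ∑ π : Equiv.Perm P, ∏ p, star (φ p) ⬝ᵥ φ (π p) := by
  let e : Fin (Fintype.card P) ≃ P := (Fintype.equivFin P).symm
  have h := sum_moment_fin w ψ K hdes (φ ∘ e)
  have h1 : ∀ j, ∏ p, (Complex.normSq (star ((φ ∘ e) p) ⬝ᵥ ψ j) : ℂ) =
      ∏ p, (Complex.normSq (star (φ p) ⬝ᵥ ψ j) : ℂ) := fun j =>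
    Equiv.prod_comp e (fun p => (Complex.normSq (star (φ p) ⬝ᵥ ψ j) : ℂ))
  simp only [h1] at h
  rw [h, ← Equiv.sum_comp e.permCongr]
  congr 1
  refine Finset.sum_congr rfl fun π _ => ?_
  rw [← Equiv.prod_comp e]
  simp [Equiv.permCongr_apply]

theorem sum_fourier_fixed {P : Type*} [Fintype P] [DecidableEq P] {d : ℕ}
    {φ : P → Fin d → Fin d → ℂ} (hφ : ∀ p, IsONB (φ p)) (α : P → Fin (d - 1))
    (π : Equiv.Perm P) {p₀ : P} (hp : π p₀ = p₀) :
    ∑ x : P → Fin d, (∏ p, zetaRoot d ^ (((α p : ℕ) + 1) * (x p : ℕ))) *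
      ∏ p, star (φ p (x p)) ⬝ᵥ φ (π p) (x (π p)) = 0 := by
  have hd : (d : ℂ) ≠ 0 := by
    have := (α p₀).2
    exact_mod_cast (by omega : d ≠ 0)
  have h := sum_sum_update p₀ (fun x : P → Fin d =>
    (∏ p, zetaRoot d ^ (((α p : ℕ) + 1) * (x p : ℕ))) *
      ∏ p, star (φ p (x p)) ⬝ᵥ φ (π p) (x (π p)))
  rw [nsmul_eq_mul, Fintype.card_fin] at h
  refine (mul_eq_zero.mp (h.symm.trans ?_)).resolve_left hd
  refine Finset.sum_eq_zero fun x _ => ?_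
  have h1 : ∀ a, ∏ p, star (φ p (Function.update x p₀ a p)) ⬝ᵥ
      φ (π p) (Function.update x p₀ a (π p)) = ∏ p, star (φ p (x p)) ⬝ᵥ φ (π p) (x (π p)) := by
    intro a
    refine Finset.prod_congr rfl fun p _ => ?_
    by_cases hpp : p = p₀
    · subst hpp
      rw [hp, hφ, hφ]
      simp
    · have : π p ≠ p₀ := fun H => hpp (π.injective (H.trans hp.symm))
      rw [Function.update_of_ne hpp, Function.update_of_ne this]
  have h2 : ∀ a, ∏ p, zetaRoot d ^ (((α p : ℕ) + 1) * (Function.update x p₀ a p : ℕ)) =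
      zetaRoot d ^ (((α p₀ : ℕ) + 1) * (a : ℕ)) *
        ∏ p ∈ Finset.univ.erase p₀, zetaRoot d ^ (((α p : ℕ) + 1) * (x p : ℕ)) := by
    intro a
    rw [← Finset.mul_prod_erase _ _ (Finset.mem_univ p₀), Function.update_self]
    congr 1
    refine Finset.prod_congr rfl fun p hpm => ?_
    rw [Function.update_of_ne (Finset.ne_of_mem_erase hpm)]
  simp only [h1, h2]
  rw [← Finset.sum_mul, ← Finset.sum_mul, sum_exp_succ]
  simp

/-- Every permutation of a finite type without fixed points has a set containing at least half of
the points in which no nonempty subset is invariant. -/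
theorem exists_half_without_invariant {P : Type*} [Fintype P] [DecidableEq P] (π : Equiv.Perm P)
    (hπ : ∀ p, π p ≠ p) :
    ∃ A : Finset P, Fintype.card P ≤ 2 * A.card ∧
      ∀ C ⊆ A, C.Nonempty → ∃ a ∈ C, ∀ b ∈ C, π b ≠ a := by
  classical
  let r : P → P := fun p => (Quotient.mk (Equiv.Perm.SameCycle.setoid π) p).out
  have hr : ∀ p, π.SameCycle (r p) p := fun p =>
    Quotient.exact (Quotient.out_eq (Quotient.mk (Equiv.Perm.SameCycle.setoid π) p))
  have hr' : ∀ p q, π.SameCycle p q → r p = r q := fun p q h =>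
    congrArg Quotient.out (Quotient.sound (s := Equiv.Perm.SameCycle.setoid π) h)
  refine ⟨Finset.univ.filter fun p => r p ≠ p, ?_, ?_⟩
  · have h1 := Finset.card_filter_add_card_filter_not (s := (Finset.univ : Finset P))
      (fun p => r p = p)
    have h2 : (Finset.univ.filter fun p => r p = p).card ≤
        (Finset.univ.filter fun p => r p ≠ p).card := by
      refine Finset.card_le_card_of_injOn π ?_ π.injective.injOn
      intro p hp
      simp only [Finset.coe_filter, Finset.mem_univ, true_and, Set.mem_ofPred_eq] at hp ⊢
      rw [hr' (π p) p (Equiv.Perm.sameCycle_apply_left.mpr (Equiv.Perm.SameCycle.refl _ _)), hp]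
      exact (hπ p).symm
    rw [Finset.card_univ] at h1
    simp only [ne_eq] at h2 ⊢
    omega
  · intro C hC ⟨c, hc⟩
    by_contra! hcon
    have himg : C.image π = C := by
      refine (Finset.eq_of_subset_of_card_le (fun a ha => ?_)
        (Finset.card_image_of_injective C π.injective).le).symm
      obtain ⟨b, hb, rfl⟩ := hcon a ha
      exact Finset.mem_image_of_mem _ hb
    have hpow : ∀ i : ℕ, (π ^ i) c ∈ C := by
      intro i
      induction i with
      | zero => simpa using hc
      | succ i ih =>
        rw [pow_succ', Equiv.Perm.mul_apply, ← himg]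
        exact Finset.mem_image_of_mem _ ih
    obtain ⟨i, -, hi⟩ := (hr c).symm.exists_pow_eq'
    have hmem := hC (hpow i)
    rw [hi, Finset.mem_filter] at hmem
    exact hmem.2 (hr' _ _ (hr c))

theorem pow_card_mul_sum_prod {P β : Type*} [Fintype P] [DecidableEq P] [Fintype β]
    (π : Equiv.Perm P) (K : P → β → β → ℝ) (hK : ∀ p y, ∑ b, K p b y = 1) (A : Finset P)
    (hA : ∀ C ⊆ A, C.Nonempty → ∃ a ∈ C, ∀ b ∈ C, π b ≠ a) :
    (Fintype.card β : ℝ) ^ A.card * ∑ x : P → β, ∏ a ∈ A, K a (x a) (x (π a)) =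
      (Fintype.card β : ℝ) ^ Fintype.card P := by
  induction hn : A.card generalizing A with
  | zero =>
    rw [Finset.card_eq_zero] at hn
    subst hn
    simp
  | succ n ih =>
    obtain ⟨a, ha, hab⟩ := hA A subset_rfl (Finset.card_pos.mp (by omega))
    have hne : π a ≠ a := hab a ha
    have ih' := ih (A.erase a) (fun C hC => hA C (hC.trans (Finset.erase_subset _ _)))
      (by rw [Finset.card_erase_of_mem ha, hn]; rfl)
    have h := sum_sum_update a (fun x : P → β => ∏ a ∈ A, K a (x a) (x (π a)))
    rw [nsmul_eq_mul] at h
    rw [pow_succ, mul_assoc, ← h, ← ih']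
    congr 1
    refine Finset.sum_congr rfl fun x _ => ?_
    have h2 : ∀ b, ∏ c ∈ A, K c (Function.update x a b c) (Function.update x a b (π c)) =
        K a b (x (π a)) * ∏ c ∈ A.erase a, K c (x c) (x (π c)) := by
      intro b
      rw [← Finset.mul_prod_erase _ _ ha, Function.update_self, Function.update_of_ne hne]
      congr 1
      refine Finset.prod_congr rfl fun c hc => ?_
      rw [Function.update_of_ne (Finset.ne_of_mem_erase hc),
        Function.update_of_ne (hab c (Finset.mem_of_mem_erase hc))]
    simp only [h2]
    rw [← Finset.sum_mul, hK, one_mul]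

theorem sum_prod_derangement_le {P : Type*} [Fintype P] [DecidableEq P] {d : ℕ} (hd : 1 ≤ d)
    {φ : P → Fin d → Fin d → ℂ} (hφ : ∀ p, IsONB (φ p)) (π : Equiv.Perm P)
    (hπ : ∀ p, π p ≠ p) :
    ∑ x : P → Fin d, ‖∏ p, star (φ p (x p)) ⬝ᵥ φ (π p) (x (π p))‖ ^ 2 ≤
      √d ^ Fintype.card P := by
  obtain ⟨A, hcard, hA⟩ := exists_half_without_invariant π hπ
  let K : P → Fin d → Fin d → ℝ := fun p a b => Complex.normSq (star (φ p a) ⬝ᵥ φ (π p) b)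
  have hK : ∀ p y, ∑ b, K p b y = 1 := fun p y =>
    (hφ p).sum_normSq (by rw [hφ (π p), if_pos rfl])
  have hK1 : ∀ p a b, K p a b ≤ 1 := fun p a b => by
    rw [← hK p b]
    exact Finset.single_le_sum (f := fun a => K p a b) (fun _ _ => Complex.normSq_nonneg _)
      (Finset.mem_univ a)
  have h := pow_card_mul_sum_prod π K hK A hA
  rw [Fintype.card_fin] at h
  have hd' : (1 : ℝ) ≤ d := by exact_mod_cast hd
  have hs : (1 : ℝ) ≤ √d := Real.one_le_sqrt.mpr hd'
  have hsq : (d : ℝ) = √d ^ 2 := (Real.sq_sqrt (by positivity)).symm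
  calc _ = ∑ x : P → Fin d, ∏ p, K p (x p) (x (π p)) := by
        refine Finset.sum_congr rfl fun x _ => ?_
        rw [norm_prod, ← Finset.prod_pow]
        exact Finset.prod_congr rfl fun p _ => (Complex.normSq_eq_norm_sq _).symm
    _ ≤ ∑ x : P → Fin d, ∏ p ∈ A, K p (x p) (x (π p)) := by
        refine Finset.sum_le_sum fun x _ => ?_
        rw [← Finset.prod_sdiff (Finset.subset_univ A)]
        exact mul_le_of_le_one_left (Finset.prod_nonneg fun _ _ => Complex.normSq_nonneg _)
          (Finset.prod_le_one (fun _ _ => Complex.normSq_nonneg _) fun _ _ => hK1 _ _ _)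
    _ ≤ √d ^ Fintype.card P := by
        refine le_of_mul_le_mul_left ?_ (by positivity : (0 : ℝ) < (d : ℝ) ^ A.card)
        rw [h]
        nth_rw 1 2 [hsq]
        rw [← pow_mul, ← pow_mul, ← pow_add]
        exact pow_le_pow_right₀ hs (by omega)

theorem sum_norm_moment_fourier_le {P : Type*} [Fintype P] [DecidableEq P] {d : ℕ} (hd : 1 ≤ d)
    {J : Type*} [Fintype J] (w : J → ℝ) (ψ : J → Fin d → ℂ)
    (hdes : ∑ j, (w j : ℂ) • tpow (Fintype.card P) (projVec (ψ j)) =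
      (∏ i ∈ Finset.range (Fintype.card P), ((d : ℂ) + i))⁻¹ •
        ∑ π : Equiv.Perm (Fin (Fintype.card P)), permMat π)
    {φ : P → Fin d → Fin d → ℂ} (hφ : ∀ p, IsONB (φ p)) :
    ∑ α : P → Fin (d - 1), ‖∑ j, (w j : ℂ) * ∏ p, ∑ y : Fin d,
        zetaRoot d ^ (((α p : ℕ) + 1) * (y : ℕ)) *
          (Complex.normSq (star (φ p y) ⬝ᵥ ψ j) : ℂ)‖ ^ 2 ≤
      ((Fintype.card P).factorial : ℝ) ^ 2 / √d ^ Fintype.card P := by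
  set u := Fintype.card P with hu
  set K : ℂ := (∏ i ∈ Finset.range u, ((d : ℂ) + i))⁻¹ with hK
  have hd' : (1 : ℝ) ≤ d := by exact_mod_cast hd
  have hs : (0 : ℝ) < √d := Real.sqrt_pos.mpr (by positivity)
  have hsq : (d : ℝ) = √d * √d := (Real.mul_self_sqrt (by positivity)).symm
  have hKn : ‖K‖ ≤ ((d : ℝ) ^ u)⁻¹ := by
    rw [hK, norm_inv, norm_prod]
    apply inv_anti₀ (by positivity)
    calc (d : ℝ) ^ u = ∏ i ∈ Finset.range u, (d : ℝ) := by simp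
      _ ≤ _ := by
        refine Finset.prod_le_prod (fun _ _ => by positivity) fun i _ => ?_
        rw [show (d : ℂ) + i = ((d + i : ℕ) : ℂ) by push_cast; ring, Complex.norm_natCast]
        push_cast
        linarith [(Nat.cast_nonneg i : (0 : ℝ) ≤ i)]
  let T : Equiv.Perm P → (P → Fin (d - 1)) → ℂ := fun π α =>
    ∑ x : P → Fin d, (∏ p, zetaRoot d ^ (((α p : ℕ) + 1) * (x p : ℕ))) *
      ∏ p, star (φ p (x p)) ⬝ᵥ φ (π p) (x (π p))
  have hT : ∀ α : P → Fin (d - 1), ∑ j, (w j : ℂ) * ∏ p, ∑ y : Fin d,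
        zetaRoot d ^ (((α p : ℕ) + 1) * (y : ℕ)) *
          (Complex.normSq (star (φ p y) ⬝ᵥ ψ j) : ℂ) = K * ∑ π, T π α := by
    intro α
    calc _ = ∑ x : P → Fin d, (∏ p, zetaRoot d ^ (((α p : ℕ) + 1) * (x p : ℕ))) *
          ∑ j, (w j : ℂ) * ∏ p, (Complex.normSq (star (φ p (x p)) ⬝ᵥ ψ j) : ℂ) := by
          simp only [Fintype.prod_sum, Finset.mul_sum]
          rw [Finset.sum_comm]
          refine Finset.sum_congr rfl fun x _ => Finset.sum_congr rfl fun j _ => ?_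
          rw [Finset.prod_mul_distrib]
          ring
      _ = K * ∑ π, T π α := by
          simp only [T]
          rw [Finset.sum_comm, Finset.mul_sum]
          refine Finset.sum_congr rfl fun x _ => ?_
          rw [sum_moment w ψ K hdes (fun p => φ p (x p)), ← Finset.mul_sum]
          ring
  have hTπ : ∀ π, ∑ α, ‖T π α‖ ^ 2 ≤ (d : ℝ) ^ u * √d ^ u := by
    intro π
    by_cases hπ : ∀ p, π p ≠ p
    · exact (sum_norm_fourier_le _).trans
        (mul_le_mul_of_nonneg_left (sum_prod_derangement_le hd hφ π hπ) (by positivity))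
    · push Not at hπ
      obtain ⟨p, hp⟩ := hπ
      have : ∀ α, T π α = 0 := fun α => sum_fourier_fixed hφ α π hp
      simp only [this]
      simp only [norm_zero, ne_eq, OfNat.ofNat_ne_zero, not_false_eq_true, zero_pow,
        Finset.sum_const_zero]
      positivity
  have hcard : (Finset.univ : Finset (Equiv.Perm P)).card = u.factorial := by
    rw [Finset.card_univ, Fintype.card_perm]
  calc _ = ∑ α, ‖K * ∑ π, T π α‖ ^ 2 := by simp only [hT]
    _ ≤ ∑ α, (((d : ℝ) ^ u)⁻¹) ^ 2 * (u.factorial * ∑ π, ‖T π α‖ ^ 2) := by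
        refine Finset.sum_le_sum fun α _ => ?_
        rw [norm_mul, mul_pow]
        gcongr
        calc _ ≤ (∑ π, ‖T π α‖) ^ 2 := by gcongr; exact norm_sum_le _ _
          _ ≤ _ := by
            have := sq_sum_le_card_mul_sum_sq (s := Finset.univ) (f := fun π => ‖T π α‖)
            rwa [hcard] at this
    _ = (((d : ℝ) ^ u)⁻¹) ^ 2 * (u.factorial * ∑ π, ∑ α, ‖T π α‖ ^ 2) := by
        rw [← Finset.mul_sum, ← Finset.mul_sum, Finset.sum_comm]
    _ ≤ (((d : ℝ) ^ u)⁻¹) ^ 2 * (u.factorial * (u.factorial * ((d : ℝ) ^ u * √d ^ u))) := by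
        gcongr
        refine (Finset.sum_le_sum fun π _ => hTπ π).trans ?_
        rw [Finset.sum_const, hcard, nsmul_eq_mul]
    _ = _ := by
        rw [hsq, mul_pow, ← hsq]
        field_simp

theorem sum_sum_prod_quadratic {ι β : Type*} [Fintype ι] [DecidableEq ι] [Fintype β]
    (φ : ι → β → ℂ) (K : ι → β → β → ℂ) :
    ∑ f : ι → β, ∑ g : ι → β, (∏ i, star (φ i (f i))) * (∏ i, K i (f i) (g i)) * ∏ i, φ i (g i) =
      ∏ i, ∑ a, ∑ b, star (φ i a) * K i a b * φ i b := by
  simp only [Fintype.prod_sum, Finset.prod_mul_distrib]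

theorem sum_prod_rows {ι τ β : Type*} [Fintype ι] [DecidableEq ι] [Fintype τ] [DecidableEq τ]
    [Fintype β] (F : ι → (τ → β) → ℂ) :
    ∑ f : ι × τ → β, ∏ l, F l (fun i => f (l, i)) = ∏ l, ∑ h : τ → β, F l h := by
  rw [Fintype.prod_sum, ← Equiv.sum_comp (Equiv.curry ι τ β)]
  rfl

/-- The readout probability of one copy, where `q i` is the probability of the outcome at the
`i`-th qudit under the planted state. -/
noncomputable def rowProb {n : ℕ} (d : ℕ) (κ : ℝ) (S : Finset (Fin n)) (q : Fin n → ℝ) : ℝ :=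
  κ * (∏ i, ((d : ℝ)⁻¹ + if i ∈ S then q i - (d : ℝ)⁻¹ else 0)) +
    (1 - κ) * ∏ _i : Fin n, (d : ℝ)⁻¹

theorem quadratic_sigmaPB {d n : ℕ} (κ : ℝ) (v : Fin d → ℂ) (S : Finset (Fin n))
    (φ : Fin n → Fin d → ℂ) (hφ : ∀ i, star (φ i) ⬝ᵥ φ i = 1) :
    ∑ f : Fin n → Fin d, ∑ g : Fin n → Fin d,
      (∏ i, star (φ i (f i))) * sigmaPB κ (projVec v) S f g * ∏ i, φ i (g i) =
      (rowProb d κ S fun i => Complex.normSq (star (φ i) ⬝ᵥ v) : ℝ) := by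
  have hmm : ∀ i, ∑ a, ∑ b, star (φ i a) * mmEntry d a b * φ i b = (d : ℂ)⁻¹ := by
    intro i
    have : ∀ a, ∑ b, star (φ i a) * mmEntry d a b * φ i b =
        (d : ℂ)⁻¹ * (star (φ i a) * φ i a) := by
      intro a
      rw [Finset.sum_eq_single a]
      · simp [mmEntry]; ring
      · intro b _ hb
        simp [mmEntry, hb.symm]
      · simp
    simp only [this]
    rw [← Finset.mul_sum]
    have h := hφ i
    simp only [dotProduct, Pi.star_apply] at h
    rw [h, mul_one]
  have hpr : ∀ i, ∑ a, ∑ b, star (φ i a) * projVec v a b * φ i b =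
      (Complex.normSq (star (φ i) ⬝ᵥ v) : ℂ) := by
    intro i
    rw [← Complex.mul_conj, starRingEnd_apply, ← Matrix.star_dotProduct]
    simp only [dotProduct, Finset.sum_mul_sum, projVec, Matrix.vecMulVec_apply, Pi.star_apply]
    exact Finset.sum_congr rfl fun a _ => Finset.sum_congr rfl fun b _ => by ring
  have h1 : ∀ i, ∑ a, ∑ b, star (φ i a) * (mmEntry d a b +
      if i ∈ S then projVec v a b - mmEntry d a b else 0) * φ i b =
      (((d : ℝ)⁻¹ + if i ∈ S then Complex.normSq (star (φ i) ⬝ᵥ v) - (d : ℝ)⁻¹ else 0 : ℝ) : ℂ) := by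
    intro i
    by_cases hi : i ∈ S
    · simp only [hi, if_true, add_sub_cancel, hpr]
    · simp only [hi, if_false, add_zero, hmm]
      simp
  have h2 := sum_sum_prod_quadratic φ (fun i a b => mmEntry d a b +
      if i ∈ S then projVec v a b - mmEntry d a b else 0)
  have h3 := sum_sum_prod_quadratic φ (fun _ a b => mmEntry d a b)
  simp only [h1] at h2
  simp only [hmm] at h3
  rw [rowProb]
  push_cast at h2 ⊢
  rw [← h2]
  rw [← h3, Finset.mul_sum, Finset.mul_sum, ← Finset.sum_add_distrib]
  refine Finset.sum_congr rfl fun f _ => ?_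
  rw [Finset.mul_sum, Finset.mul_sum, ← Finset.sum_add_distrib]
  refine Finset.sum_congr rfl fun g _ => ?_
  simp only [sigmaPB, Matrix.of_apply]
  push_cast
  ring

theorem quadratic_cpow {d n m : ℕ} (M : Matrix (Fin n → Fin d) (Fin n → Fin d) ℂ)
    (ψb : Fin m × Fin n → Fin d → Fin d → ℂ) (x : Fin m × Fin n → Fin d) :
    star (prodVec ψb x) ⬝ᵥ (cpow m M *ᵥ prodVec ψb x) =
      ∏ l, ∑ f : Fin n → Fin d, ∑ g : Fin n → Fin d,
        (∏ i, star (ψb (l, i) (x (l, i)) (f i))) * M f g * ∏ i, ψb (l, i) (x (l, i)) (g i) := by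
  rw [← sum_prod_rows (fun l f => ∑ g : Fin n → Fin d,
        (∏ i, star (ψb (l, i) (x (l, i)) (f i))) * M f g * ∏ i, ψb (l, i) (x (l, i)) (g i))]
  simp only [dotProduct, Matrix.mulVec]
  refine Finset.sum_congr rfl fun f _ => ?_
  rw [← sum_prod_rows (fun l g =>
        (∏ i, star (ψb (l, i) (x (l, i)) (f (l, i)))) * M (fun i => f (l, i)) g *
          ∏ i, ψb (l, i) (x (l, i)) (g i)), Finset.mul_sum]
  refine Finset.sum_congr rfl fun g _ => ?_
  simp only [prodVec, cpow, Matrix.of_apply, Pi.star_apply, star_prod, Finset.prod_mul_distrib,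
    Fintype.prod_prod_type]
  ring

theorem bicliqueLR_eq {d n m : ℕ} (κ : ℝ) {J : Type} [Fintype J] (w : J → ℝ) (ψ : J → Fin d → ℂ)
    {ψb : Fin m × Fin n → Fin d → Fin d → ℂ} (hb : ∀ p, IsONB (ψb p))
    (x : Fin m × Fin n → Fin d) :
    bicliqueLR d n m κ w ψ ψb x = (d : ℝ) ^ (m * n) * ∑ j, w j * ∑ S : Finset (Fin n),
      κ ^ S.card * (1 - κ) ^ (n - S.card) *
        ∏ l, rowProb d κ S fun i => Complex.normSq (star (ψb (l, i) (x (l, i))) ⬝ᵥ ψ j) := by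
  have h : ∀ j (S : Finset (Fin n)), star (prodVec ψb x) ⬝ᵥ
      (cpow m (sigmaPB κ (projVec (ψ j)) S) *ᵥ prodVec ψb x) =
      ((∏ l, rowProb d κ S fun i =>
        Complex.normSq (star (ψb (l, i) (x (l, i))) ⬝ᵥ ψ j) : ℝ) : ℂ) := by
    intro j S
    rw [quadratic_cpow, Complex.ofReal_prod]
    exact Finset.prod_congr rfl fun l _ => quadratic_sigmaPB κ (ψ j) S
      (fun i => ψb (l, i) (x (l, i))) (fun i => by rw [hb, if_pos rfl])
  simp only [bicliqueLR, h, Complex.ofReal_re]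

theorem sum_weight_subset {n : ℕ} (κ : ℝ) (Q : Finset (Fin n)) :
    ∑ S : Finset (Fin n), κ ^ S.card * (1 - κ) ^ (n - S.card) * (if Q ⊆ S then 1 else 0) =
      κ ^ Q.card := by
  have h := Finset.prod_add (fun _ : Fin n => κ) (fun i => if i ∈ Q then 0 else 1 - κ) Finset.univ
  rw [Finset.powerset_univ] at h
  have h1 : ∏ i, (κ + if i ∈ Q then 0 else 1 - κ) = κ ^ Q.card := by
    have : ∀ i, (κ + if i ∈ Q then 0 else 1 - κ) = if i ∈ Q then κ else 1 := by
      intro i; split_ifs <;> ring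
    simp only [this]
    rw [Finset.prod_ite_mem]
    simp
  rw [← h1, h]
  refine Finset.sum_congr rfl fun S _ => ?_
  rw [Finset.prod_const, mul_assoc]
  congr 1
  split_ifs with hQ
  · rw [mul_one, Finset.prod_congr rfl (g := fun _ => 1 - κ), Finset.prod_const,
      Finset.card_sdiff_of_subset (Finset.subset_univ S)]
    · simp
    · intro i hi
      rw [if_neg]
      exact fun hiQ => (Finset.mem_sdiff.mp hi).2 (hQ hiQ)
  · obtain ⟨i, hi, hiS⟩ := Finset.not_subset.mp hQ
    rw [mul_zero, eq_comm, Finset.prod_eq_zero (i := i)]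
    · simp [hiS]
    · simp [hi]

theorem sum_rowProb_mul {d n : ℕ} (κ : ℝ) (S : Finset (Fin n)) (q : Fin n → Fin d → ℝ)
    (c : Fin n → Fin d → ℂ) (hd : 1 ≤ d) (hq : ∀ i, ∑ y, q i y = 1) (V : Finset (Fin n))
    (hc1 : ∀ i ∉ V, ∀ y, c i y = 1) (hc0 : ∀ i ∈ V, ∑ y, c i y = 0) :
    ∑ x : Fin n → Fin d, (rowProb d κ S (fun i => q i (x i)) : ℂ) * ∏ i, c i (x i) =
      if V.Nonempty then κ * ∏ i ∈ V, (if i ∈ S then ∑ y, c i y * q i y else 0) else 1 := by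
  have hd' : (d : ℂ) ≠ 0 := by exact_mod_cast (by omega : d ≠ 0)
  have h1 : ∑ x : Fin n → Fin d, (rowProb d κ S (fun i => q i (x i)) : ℂ) * ∏ i, c i (x i) =
      κ * (∏ i, ∑ y, ((d : ℂ)⁻¹ + if i ∈ S then (q i y : ℂ) - (d : ℂ)⁻¹ else 0) * c i y) +
        (1 - κ) * ∏ i, ∑ y, (d : ℂ)⁻¹ * c i y := by
    rw [Fintype.prod_sum, Fintype.prod_sum, Finset.mul_sum, Finset.mul_sum,
      ← Finset.sum_add_distrib]
    refine Finset.sum_congr rfl fun x _ => ?_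
    rw [rowProb, Finset.prod_mul_distrib, Finset.prod_mul_distrib]
    push_cast [apply_ite (Complex.ofReal)]
    ring
  have h2 : ∀ i, ∑ y, ((d : ℂ)⁻¹ + if i ∈ S then (q i y : ℂ) - (d : ℂ)⁻¹ else 0) * c i y =
      if i ∈ V then (if i ∈ S then ∑ y, c i y * q i y else 0) else 1 := by
    intro i
    have hqi : ∑ y, (q i y : ℂ) = 1 := by exact_mod_cast hq i
    by_cases hV : i ∈ V
    · by_cases hS : i ∈ S
      · simp [hV, hS, mul_comm]
      · simp [hV, hS, ← Finset.mul_sum, hc0]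
    · by_cases hS : i ∈ S <;> simp [hV, hS, hc1, hqi, hd']
  have h3 : ∀ i, ∑ y, (d : ℂ)⁻¹ * c i y = if i ∈ V then 0 else 1 := by
    intro i
    by_cases hV : i ∈ V
    · rw [← Finset.mul_sum, hc0 i hV]; simp [hV]
    · simp [hV, hc1, hd']
  rw [h1]
  simp only [h2, h3]
  rw [Finset.prod_ite_mem, Finset.univ_inter]
  split_ifs with hV
  · obtain ⟨i, hi⟩ := hV
    rw [Finset.prod_eq_zero (s := Finset.univ) (Finset.mem_univ i) (by simp [hi])]
    ring
  · rw [Finset.not_nonempty_iff_eq_empty] at hV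
    subst hV
    simp

theorem bicliqueFourier_eq {d n m : ℕ} (hd : 1 ≤ d) (κ : ℝ) {J : Type} [Fintype J] (w : J → ℝ)
    (ψ : J → Fin d → ℂ) (hψ : ∀ j, star (ψ j) ⬝ᵥ ψ j = 1)
    {ψb : Fin m × Fin n → Fin d → Fin d → ℂ} (hb : ∀ p, IsONB (ψb p))
    (W : Finset (Fin m × Fin n)) (α : {p // p ∈ W} → Fin (d - 1)) :
    bicliqueFourier d n m κ w ψ ψb W α =
      (κ : ℂ) ^ ((W.image Prod.fst).card + (W.image Prod.snd).card) *
        ∑ j, (w j : ℂ) * ∏ p : {p // p ∈ W}, ∑ y : Fin d,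
          zetaRoot d ^ (((α p : ℕ) + 1) * (y : ℕ)) *
            (Complex.normSq (star (ψb p y) ⬝ᵥ ψ j) : ℂ) := by
  classical
  have hd' : (d : ℂ) ≠ 0 := by exact_mod_cast (by omega : d ≠ 0)
  let c : Fin m × Fin n → Fin d → ℂ := fun p y =>
    if hp : p ∈ W then zetaRoot d ^ (((α ⟨p, hp⟩ : ℕ) + 1) * (y : ℕ)) else 1
  let q : J → Fin m × Fin n → Fin d → ℝ := fun j p y => Complex.normSq (star (ψb p y) ⬝ᵥ ψ j)
  let V : Fin m → Finset (Fin n) := fun l => Finset.univ.filter fun i => (l, i) ∈ W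
  have hc : ∀ x : Fin m × Fin n → Fin d, ∏ p : {p // p ∈ W},
      zetaRoot d ^ (((α p : ℕ) + 1) * (x p.val : ℕ)) = ∏ l, ∏ i, c (l, i) (x (l, i)) := by
    intro x
    rw [← Fintype.prod_prod_type' (f := fun l i => c (l, i) (x (l, i)))]
    have h : ∏ p ∈ W, c p (x p) = ∏ p, c p (x p) :=
      Finset.prod_subset (Finset.subset_univ W) fun p _ hp => by simp [c, hp]
    simp only [Prod.mk.eta]
    rw [← h, ← Finset.prod_coe_sort W]
    refine Finset.prod_congr rfl fun p _ => ?_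
    simp [c, p.2]
  have hrow : ∀ j S, ∑ x : Fin m × Fin n → Fin d,
      (∏ l, (rowProb d κ S (fun i => q j (l, i) (x (l, i))) : ℂ)) *
        ∏ l, ∏ i, c (l, i) (x (l, i)) =
      (κ : ℂ) ^ (W.image Prod.fst).card * ((if W.image Prod.snd ⊆ S then 1 else 0) *
        ∏ p ∈ W, ∑ y, c p y * q j p y) := by
    intro j S
    simp only [← Finset.prod_mul_distrib]
    rw [sum_prod_rows (fun l x => (rowProb d κ S (fun i => q j (l, i) (x i)) : ℂ) *
      ∏ i, c (l, i) (x i))]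
    have h1 : ∀ l, _ := fun l => sum_rowProb_mul κ S (fun i => q j (l, i)) (fun i => c (l, i)) hd
      (fun i => (hb (l, i)).sum_normSq (hψ j)) (V l)
      (fun i hi y => by
        have : (l, i) ∉ W := by simpa [V] using hi
        simp [c, this])
      (fun i hi => by
        have : (l, i) ∈ W := by simpa [V] using hi
        simp only [c, this, dif_pos]
        exact sum_exp_succ _)
    simp only [h1]
    have h2 : ∀ l, (if (V l).Nonempty then (κ : ℂ) * ∏ i ∈ V l,
        (if i ∈ S then ∑ y, c (l, i) y * q j (l, i) y else 0) else 1) =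
        (if l ∈ W.image Prod.fst then (κ : ℂ) else 1) * ∏ i,
          if (l, i) ∈ W then (if i ∈ S then ∑ y, c (l, i) y * q j (l, i) y else 0) else 1 := by
      intro l
      have hl : (V l).Nonempty ↔ l ∈ W.image Prod.fst := by
        simp [V, Finset.Nonempty]
      rw [← Finset.prod_filter]
      by_cases h : (V l).Nonempty
      · rw [if_pos h, if_pos (hl.mp h)]
      · rw [if_neg h, if_neg (fun H => h (hl.mpr H))]
        rw [Finset.not_nonempty_iff_eq_empty] at h
        simp only [V] at h
        rw [h]; simp
    simp only [h2]
    rw [Finset.prod_mul_distrib, Finset.prod_ite_mem, Finset.univ_inter, Finset.prod_const]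
    congr 1
    rw [← Fintype.prod_prod_type' (f := fun l i => if (l, i) ∈ W then
      (if i ∈ S then ∑ y, c (l, i) y * q j (l, i) y else 0) else 1)]
    simp only [Prod.mk.eta]
    rw [Finset.prod_ite_mem, Finset.univ_inter, Finset.prod_ite_zero]
    have : (∀ p ∈ W, p.2 ∈ S) ↔ W.image Prod.snd ⊆ S := by
      rw [Finset.image_subset_iff]
    simp only [this]
    split_ifs <;> simp
  have hS : ∑ S : Finset (Fin n), (κ : ℂ) ^ S.card * (1 - κ) ^ (n - S.card) *
      (if W.image Prod.snd ⊆ S then 1 else 0) = (κ : ℂ) ^ (W.image Prod.snd).card := by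
    have := sum_weight_subset κ (W.image Prod.snd)
    rw [← Complex.ofReal_inj] at this
    push_cast [apply_ite (Complex.ofReal)] at this
    exact this
  have hW : ∀ j, ∏ p ∈ W, ∑ y, c p y * q j p y = ∏ p : {p // p ∈ W}, ∑ y : Fin d,
          zetaRoot d ^ (((α p : ℕ) + 1) * (y : ℕ)) *
            (Complex.normSq (star (ψb p y) ⬝ᵥ ψ j) : ℂ) := by
    intro j
    rw [← Finset.prod_coe_sort]
    refine Finset.prod_congr rfl fun p _ => ?_
    simp [c, q, p.2]
  calc _ = ∑ j, (w j : ℂ) * ∑ S : Finset (Fin n), (κ : ℂ) ^ S.card * (1 - κ) ^ (n - S.card) *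
        ∑ x : Fin m × Fin n → Fin d,
        (∏ l, (rowProb d κ S (fun i => q j (l, i) (x (l, i))) : ℂ)) *
          ∏ l, ∏ i, c (l, i) (x (l, i)) := by
        simp only [bicliqueFourier, bicliqueLR_eq κ w ψ hb]
        simp only [hc]
        push_cast
        rw [Finset.mul_sum]
        have : ∀ A B : ℂ, ((d : ℂ) ^ (m * n))⁻¹ * ((d : ℂ) ^ (m * n) * A * B) = A * B := by
          intro A B
          field_simp
        simp only [this]
        simp only [Finset.sum_mul, Finset.mul_sum]
        rw [Finset.sum_comm]
        refine Finset.sum_congr rfl fun j _ => ?_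
        rw [Finset.sum_comm]
        refine Finset.sum_congr rfl fun S _ => Finset.sum_congr rfl fun x _ => ?_
        simp only [q]
        ring
    _ = _ := by
        simp only [hrow, hW]
        rw [Finset.mul_sum]
        refine Finset.sum_congr rfl fun j _ => ?_
        rw [pow_add, ← hS, Finset.mul_sum, Finset.mul_sum, Finset.sum_mul]
        refine Finset.sum_congr rfl fun S _ => ?_
        ring

theorem sum_touching_le {m n k : ℕ} (h : ℕ → ℕ → ℕ → ℝ) (hh : ∀ t s u, 0 ≤ h t s u) :
    ∑ W : Finset (Fin m × Fin n) with 1 ≤ W.card ∧ W.card ≤ k,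
        h (W.image Prod.fst).card (W.image Prod.snd).card W.card ≤
      ∑ t ∈ Finset.Icc 1 k, ∑ s ∈ Finset.Icc 1 k, ∑ u ∈ Finset.Icc t k,
        ((m : ℝ) ^ t * (n : ℝ) ^ s * ((t * s).choose u : ℕ)) * h t s u := by
  classical
  have hmaps : ∀ W ∈ Finset.univ.filter
      (fun W : Finset (Fin m × Fin n) => 1 ≤ W.card ∧ W.card ≤ k),
      (⟨(W.image Prod.fst).card, (W.image Prod.snd).card, W.card⟩ : (_ : ℕ) × ℕ × ℕ) ∈
        (Finset.Icc 1 k).sigma fun t => (Finset.Icc 1 k) ×ˢ (Finset.Icc t k) := by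
    intro W hW
    obtain ⟨h1, h2⟩ := (Finset.mem_filter.mp hW).2
    have hne : W.Nonempty := Finset.card_pos.mp h1
    have h3 := (hne.image Prod.fst).card_pos
    have h4 := (hne.image Prod.snd).card_pos
    have h5 : (W.image Prod.fst).card ≤ W.card := Finset.card_image_le
    have h6 : (W.image Prod.snd).card ≤ W.card := Finset.card_image_le
    simp only [Finset.mem_sigma, Finset.mem_product, Finset.mem_Icc]
    omega
  rw [← Finset.sum_fiberwise_of_maps_to hmaps, Finset.sum_sigma]
  refine Finset.sum_le_sum fun t _ => ?_
  rw [Finset.sum_product]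
  refine Finset.sum_le_sum fun s _ => Finset.sum_le_sum fun u _ => ?_
  set F := (Finset.univ.filter
      (fun W : Finset (Fin m × Fin n) => 1 ≤ W.card ∧ W.card ≤ k)).filter (fun W =>
      (⟨(W.image Prod.fst).card, (W.image Prod.snd).card, W.card⟩ : (_ : ℕ) × ℕ × ℕ) =
        ⟨t, s, u⟩) with hF
  have hF' : ∀ W ∈ F, (W.image Prod.fst).card = t ∧ (W.image Prod.snd).card = s ∧ W.card = u := by
    intro W hW
    simpa using (Finset.mem_filter.mp hW).2
  have hsub : F ⊆ (Finset.powersetCard t (Finset.univ : Finset (Fin m)) ×ˢ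
      Finset.powersetCard s (Finset.univ : Finset (Fin n))).biUnion
        fun RQ => Finset.powersetCard u (RQ.1 ×ˢ RQ.2) := by
    intro W hW
    obtain ⟨h1, h2, h3⟩ := hF' W hW
    rw [Finset.mem_biUnion]
    refine ⟨(W.image Prod.fst, W.image Prod.snd), ?_, ?_⟩
    · simp [Finset.mem_powersetCard, h1, h2]
    · rw [Finset.mem_powersetCard]
      exact ⟨Finset.subset_product, h3⟩
  have hcard : F.card ≤ m ^ t * n ^ s * (t * s).choose u := by
    refine (Finset.card_le_card hsub).trans ((Finset.card_biUnion_le_card_mul _ _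
      ((t * s).choose u) ?_).trans ?_)
    · rintro ⟨R, Q⟩ hRQ
      simp only [Finset.mem_product, Finset.mem_powersetCard] at hRQ
      rw [Finset.card_powersetCard, Finset.card_product, hRQ.1.2, hRQ.2.2]
    · rw [Finset.card_product, Finset.card_powersetCard, Finset.card_powersetCard]
      simp only [Finset.card_univ, Fintype.card_fin]
      gcongr <;> exact Nat.choose_le_pow _ _
  calc _ = ∑ W ∈ F, h t s u := by
        refine Finset.sum_congr rfl fun W hW => ?_
        obtain ⟨h1, h2, h3⟩ := hF' W hW
        rw [h1, h2, h3]
    _ = F.card * h t s u := by rw [Finset.sum_const, nsmul_eq_mul]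
    _ ≤ _ := by
        gcongr
        · exact hh t s u
        · exact_mod_cast hcard

theorem choose_mul_factorial_sq_le {t s u k : ℕ} (ht : t ≤ k) (hs : s ≤ k) (hu : u ≤ k) :
    (t * s).choose u * u.factorial ^ 2 ≤ (k ^ 3) ^ u := by
  calc (t * s).choose u * u.factorial ^ 2
      = (u.factorial * (t * s).choose u) * u.factorial := by ring
    _ = (t * s).descFactorial u * u.factorial := by
        rw [Nat.descFactorial_eq_factorial_mul_choose]
    _ ≤ (t * s) ^ u * u ^ u :=
        Nat.mul_le_mul (Nat.descFactorial_le_pow _ _) (Nat.factorial_le_pow u)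
    _ ≤ (k * k) ^ u * k ^ u := by gcongr
    _ = (k ^ 3) ^ u := by rw [← mul_pow]; ring

theorem sum_Icc_pow_le {r : ℝ} (hr0 : 0 ≤ r) (hr : r ≤ 1 / 2) {t k : ℕ} (ht : 1 ≤ t) :
    ∑ u ∈ Finset.Icc t k, r ^ u ≤ (2 * r) ^ t := by
  calc ∑ u ∈ Finset.Icc t k, r ^ u = ∑ u ∈ Finset.Ico t (k + 1), r ^ u := rfl
    _ ≤ r ^ t / (1 - r) := geom_sum_Ico_le_of_lt_one hr0 (by linarith)
    _ ≤ 2 * r ^ t := by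
        rw [div_le_iff₀ (by linarith)]
        nlinarith [pow_nonneg hr0 t]
    _ ≤ 2 ^ t * r ^ t := by
        gcongr
        exact le_self_pow₀ (by norm_num) (by omega)
    _ = (2 * r) ^ t := (mul_pow _ _ _).symm

/-- low-degree Fourier mass bound for quantum planted biclique under local
measurements. -/
theorem quantum_planted_biclique_fourier_mass_bound :
    ∃ C c : ℝ, 0 < C ∧ 0 < c ∧
      ∀ (d n m k : ℕ), 1 ≤ d → 1 ≤ n → 1 ≤ m → 1 ≤ k →
      ((k : ℝ) ^ 3 ≤ c * Real.sqrt d) →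
      ∀ lam : ℝ, 0 ≤ lam → lam ≤ (n : ℝ) →
      ∀ (J : Type) [Fintype J] (w : J → ℝ), (∀ j, 0 ≤ w j) → (∑ j, w j) = 1 →
      ∀ ψ : J → Fin d → ℂ, (∀ j, star (ψ j) ⬝ᵥ ψ j = 1) →
      (∀ u : ℕ, 1 ≤ u → u ≤ k →
        ∑ j, (w j : ℂ) • tpow u (projVec (ψ j))
          = (∏ i ∈ Finset.range u, ((d : ℂ) + i))⁻¹ •
              ∑ π : Equiv.Perm (Fin u), permMat π) →
      ∀ ψb : Fin m × Fin n → Fin d → Fin d → ℂ, (∀ p, IsONB (ψb p)) →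
      (∑ W : Finset (Fin m × Fin n),
          if 1 ≤ W.card ∧ W.card ≤ k then
            ∑ α : {p // p ∈ W} → Fin (d - 1),
              ‖bicliqueFourier d n m (lam / n) w ψ ψb W α‖ ^ 2
          else 0)
        ≤ (∑ t ∈ Finset.Icc 1 k,
              (C * (k : ℝ) ^ 3 * (m : ℝ) * lam ^ 2 /
                ((n : ℝ) ^ 2 * Real.sqrt d)) ^ t) *
            (∑ s ∈ Finset.Icc 1 k, (lam ^ 2 / (n : ℝ)) ^ s) := by
  refine ⟨2, 1 / 2, by norm_num, by norm_num, ?_⟩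
  intro d n m k hd hn _ _ hk3 lam hlam _ J _ w _ _ ψ hψ hdes ψb hb
  set κ : ℝ := lam / n with hκ
  have hκ0 : 0 ≤ κ := by positivity
  have hn' : (0 : ℝ) < n := by exact_mod_cast hn
  have hd' : (0 : ℝ) < d := by exact_mod_cast hd
  have hs : 0 < √(d : ℝ) := Real.sqrt_pos.mpr hd'
  set r : ℝ := (k : ℝ) ^ 3 / √d with hr
  have hr0 : 0 ≤ r := by positivity
  have hr2 : r ≤ 1 / 2 := by rwa [hr, div_le_iff₀ hs]
  let h : ℕ → ℕ → ℕ → ℝ := fun t s u => (κ ^ (t + s)) ^ 2 * ((u.factorial : ℝ) ^ 2 / √d ^ u)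
  have hW : ∀ W : Finset (Fin m × Fin n), 1 ≤ W.card → W.card ≤ k →
      ∑ α : {p // p ∈ W} → Fin (d - 1), ‖bicliqueFourier d n m κ w ψ ψb W α‖ ^ 2 ≤
        h (W.image Prod.fst).card (W.image Prod.snd).card W.card := by
    intro W h1 h2
    have hcard : Fintype.card {p // p ∈ W} = W.card := Fintype.card_coe W
    have hm := sum_norm_moment_fourier_le (P := {p // p ∈ W}) hd w ψ
      (hdes _ (by rwa [hcard]) (by rwa [hcard])) (φ := fun p => ψb p) (fun p => hb p)
    rw [hcard] at hm
    simp only [bicliqueFourier_eq hd κ w ψ hψ hb, norm_mul, mul_pow, norm_pow, Complex.norm_real,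
      Real.norm_of_nonneg hκ0]
    rw [← Finset.mul_sum]
    exact mul_le_mul_of_nonneg_left hm (by positivity)
  calc _ ≤ ∑ W : Finset (Fin m × Fin n) with 1 ≤ W.card ∧ W.card ≤ k,
        h (W.image Prod.fst).card (W.image Prod.snd).card W.card := by
        rw [← Finset.sum_filter]
        refine Finset.sum_le_sum fun W hWm => ?_
        obtain ⟨h1, h2⟩ := (Finset.mem_filter.mp hWm).2
        exact hW W h1 h2
    _ ≤ _ := sum_touching_le h (fun t s u => by positivity)
    _ ≤ ∑ t ∈ Finset.Icc 1 k, ∑ s ∈ Finset.Icc 1 k, ∑ u ∈ Finset.Icc t k,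
          (m * κ ^ 2) ^ t * (n * κ ^ 2) ^ s * r ^ u := by
        refine Finset.sum_le_sum fun t ht => Finset.sum_le_sum fun s hs' =>
          Finset.sum_le_sum fun u hu => ?_
        rw [Finset.mem_Icc] at ht hs' hu
        have hc : (((t * s).choose u : ℕ) : ℝ) * (u.factorial : ℝ) ^ 2 ≤ ((k : ℝ) ^ 3) ^ u := by
          exact_mod_cast choose_mul_factorial_sq_le ht.2 hs'.2 hu.2
        calc _ = ((m * κ ^ 2) ^ t * (n * κ ^ 2) ^ s) *
              ((((t * s).choose u : ℕ) : ℝ) * (u.factorial : ℝ) ^ 2 / √d ^ u) := by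
              simp only [h]
              ring
          _ ≤ _ := by
              rw [hr, div_pow _ √(d : ℝ)]
              gcongr
    _ ≤ ∑ t ∈ Finset.Icc 1 k, ∑ s ∈ Finset.Icc 1 k,
          (m * κ ^ 2) ^ t * (n * κ ^ 2) ^ s * (2 * r) ^ t := by
        refine Finset.sum_le_sum fun t ht => Finset.sum_le_sum fun s _ => ?_
        rw [← Finset.mul_sum]
        exact mul_le_mul_of_nonneg_left (sum_Icc_pow_le hr0 hr2 (Finset.mem_Icc.mp ht).1)
          (by positivity)
    _ = _ := by
        rw [Finset.sum_mul_sum]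
        refine Finset.sum_congr rfl fun t _ => Finset.sum_congr rfl fun s _ => ?_
        have e1 : 2 * (k : ℝ) ^ 3 * m * lam ^ 2 / (n ^ 2 * √d) = m * κ ^ 2 * (2 * r) := by
          rw [hκ, hr]
          field_simp
        have e2 : lam ^ 2 / n = n * κ ^ 2 := by
          rw [hκ]
          field_simp
        rw [e1, e2, mul_pow (m * κ ^ 2) (2 * r)]
        ring
end
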